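/- arXiv:2106.10175 — 5 statements merged into one kernel-verified Lean document; each statement's English description precedes it below -/
import Mathlib

section
/- Let λ > 0, let n ≥ 1, let 0 = t₀ ≤ t₁ < t₂ < … < tₙ, and let F₀ : ℝ₊ⁿ → [0,∞] be measurable with F₀(0,…,0) = 0. Then λ ∫₀^∞ F₀(1_{[s,∞)}(t₁), …, 1_{[s,∞)}(tₙ)) ds = λ ∑_{i=1}^{n} (tᵢ − tᵢ₋₁) F₀(uᵢ), where uᵢ ∈ ℝⁿ is the vector whose first i−1 coordinates equal 0 and whose remaining coordinates equal 1. (This identifies the finite-dimensional projections of the path-space measure ν(F) = λ∫₀^∞ F(1_{[s,∞)}) ds, showing it is the Lévy measure of the Poisson process with intensity λ.) -/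
open MeasureTheory ProbabilityTheory Set
open scoped ENNReal NNReal

/-- A lower integral over `(t 0, t k]` splits along a monotone subdivision. -/
theorem lintegral_Ioc_eq_sum_range {t : ℕ → ℝ} {n : ℕ} (ht : MonotoneOn t (Set.Iic n))
    (μ : Measure ℝ) (f : ℝ → ℝ≥0∞) {k : ℕ} (hk : k ≤ n) :
    ∫⁻ s in Set.Ioc (t 0) (t k), f s ∂μ =
      ∑ i ∈ Finset.range k, ∫⁻ s in Set.Ioc (t i) (t (i + 1)), f s ∂μ := by
  induction k with
  | zero => simp
  | succ k ih =>
    have h0k : t 0 ≤ t k := ht (by simp) (by simp; omega) (Nat.zero_le k)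
    have hkk : t k ≤ t (k + 1) := ht (by simp; omega) hk (Nat.le_succ k)
    rw [Finset.sum_range_succ, ← ih (by omega), ← Set.Ioc_union_Ioc_eq_Ioc h0k hkk,
      lintegral_union measurableSet_Ioc (Set.Ioc_disjoint_Ioc_of_le le_rfl)]

/-- On `(t i, t (i + 1)]`, the jump times `t (j + 1)` that are at least `s` are those with
`i ≤ j`. -/
theorem le_apply_succ_iff_of_mem_Ioc {t : ℕ → ℝ} {n : ℕ} (ht : MonotoneOn t (Set.Iic n))
    {i j : ℕ} (hi : i < n) (hj : j < n) {s : ℝ} (hs : s ∈ Set.Ioc (t i) (t (i + 1))) :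
    s ≤ t (j + 1) ↔ i ≤ j := by
  refine ⟨fun h => ?_, fun h => hs.2.trans (ht hi hj (by omega))⟩
  by_contra! hji
  exact (hs.1.trans_le h).not_ge (ht hj hi.le hji)

/-- For `λ > 0`, times `0 = t₀ ≤ t₁ < t₂ < … < tₙ` and a measurable
`F₀ : ℝ₊ⁿ → [0,∞]` with `F₀(0,…,0) = 0`, the integral
`λ ∫₀^∞ F₀(1_{[s,∞)}(t₁), …, 1_{[s,∞)}(tₙ)) ds` equals
`λ ∑_{i=1}^n (tᵢ − tᵢ₋₁) F₀(uᵢ)`, where `uᵢ` has its first `i−1` coordinates `0`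
and the remaining ones `1`.  (Coordinate `j : Fin n` corresponds to `t_{j+1}`.) -/
theorem levyMeasure_poisson_fdd (lam : ℝ) (hlam : 0 < lam) (n : ℕ) (hn : 1 ≤ n)
    (t : ℕ → ℝ) (ht0 : t 0 = 0) (ht01 : t 0 ≤ t 1)
    (hmono : ∀ i, 1 ≤ i → i + 1 ≤ n → t i < t (i + 1))
    (F₀ : (Fin n → ℝ≥0) → ℝ≥0∞) (hF₀ : Measurable F₀)
    (hF₀0 : F₀ (fun _ => 0) = 0) :
    ENNReal.ofReal lam *
        ∫⁻ s in Set.Ioi (0 : ℝ),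
          F₀ (fun j => if s ≤ t (j.val + 1) then 1 else 0) =
      ENNReal.ofReal lam *
        ∑ i ∈ Finset.range n,
          ENNReal.ofReal (t (i + 1) - t i) *
            F₀ (fun j => if i ≤ j.val then 1 else 0) := by
  have hstep : ∀ i, i + 1 ≤ n → t i ≤ t (i + 1) := fun i hi => by
    rcases Nat.eq_zero_or_pos i with rfl | hpos
    · exact ht01
    · exact (hmono i hpos hi).le
  have ht : MonotoneOn t (Set.Iic n) := fun a _ b hb hab => by
    induction b, hab using Nat.le_induction with
    | base => exact le_rfl
    | succ b _ ih =>
      exact (ih ((Nat.le_succ b).trans hb)).trans (hstep b hb)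
  have htn : (0 : ℝ) ≤ t n := ht0 ▸ ht (Nat.zero_le n) Set.self_mem_Iic (Nat.zero_le n)
  have htail : ∫⁻ s in Set.Ioi (t n),
      F₀ (fun j : Fin n => if s ≤ t (j.val + 1) then 1 else 0) = 0 := by
    refine (setLIntegral_congr_fun measurableSet_Ioi fun s hs => ?_).trans lintegral_zero
    have hlt : ∀ j : Fin n, ¬ s ≤ t (j.val + 1) := fun j =>
      not_le.2 ((ht j.isLt Set.self_mem_Iic j.isLt).trans_lt hs)
    simp only [hlt, if_false, hF₀0]
  congr 1
  rw [← Set.Ioc_union_Ioi_eq_Ioi htn, lintegral_union measurableSet_Ioi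
    (Set.Ioc_disjoint_Ioi le_rfl), htail, add_zero, ← ht0,
    lintegral_Ioc_eq_sum_range ht _ _ le_rfl]
  refine Finset.sum_congr rfl fun i hi => ?_
  have hin := Finset.mem_range.1 hi
  rw [setLIntegral_congr_fun (g := fun _ => F₀ (fun j => if i ≤ j.val then 1 else 0))
    measurableSet_Ioc fun s hs => by
      simp only [le_apply_succ_iff_of_mem_Ioc ht hin (Fin.isLt _) hs],
    setLIntegral_const, Real.volume_Ioc, mul_comm]
end

section
/- Let λ > 0. Let Y be a nonnegative random variable with P(Y ≥ x) > 0 for every x ≥ 0 (its support is all of [0,∞)) and with E[Y] < ∞, let U be a standard uniform random variable independent of Y, and set h(x) = 1 / P(Y ≥ x). Then for every measurable functional F : [0,∞)^{[0,∞)} → [0,∞] (with respect to the product σ-algebra on the space of functions from [0,∞) to [0,∞)): λ ∫₀^∞ F(1_{[s,∞)}) ds = λ E[ Y · h(UY) · F(1_{[UY,∞)}) ]. In particular, if Y is a standard exponential random variable independent of U, then λ ∫₀^∞ F(1_{[s,∞)}) ds = λ E[ Y e^{UY} F(1_{[UY,∞)}) ]. -/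
open MeasureTheory ProbabilityTheory Set
open scoped ENNReal NNReal

/-- Change of variables `s = u * y` on the unit interval. -/
theorem ofReal_mul_lintegral_Icc_comp_mul {G : ℝ → ℝ≥0∞} (hG : Measurable G) {y : ℝ}
    (hy : 0 ≤ y) :
    ENNReal.ofReal y * ∫⁻ u in Icc (0 : ℝ) 1, G (u * y) =
      ∫⁻ s in Ioi (0 : ℝ), (Iic y).indicator G s := by
  rcases hy.eq_or_lt with rfl | hy
  · rw [ENNReal.ofReal_zero, zero_mul, lintegral_indicator measurableSet_Iic,
      Measure.restrict_restrict measurableSet_Iic, Iic_inter_Ioi]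
    simp
  · have hpre : ∀ u, (Icc (0 : ℝ) y).indicator G (u * y) =
        (Icc (0 : ℝ) 1).indicator (fun u => G (u * y)) u := by
      intro u
      have h : u * y ∈ Icc 0 y ↔ u ∈ Icc (0 : ℝ) 1 := by
        simp [mul_nonneg_iff_of_pos_right hy, mul_le_iff_le_one_left hy]
      simp only [indicator, h]
    calc ENNReal.ofReal y * ∫⁻ u in Icc (0 : ℝ) 1, G (u * y)
        = ENNReal.ofReal |y| * ∫⁻ u, (Icc (0 : ℝ) y).indicator G (u * y) := by
          rw [abs_of_pos hy, ← lintegral_indicator measurableSet_Icc]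
          simp only [hpre]
      _ = ∫⁻ s, (Icc (0 : ℝ) y).indicator G s := by
          conv_rhs => rw [← Real.smul_map_volume_mul_right hy.ne']
          rw [lintegral_smul_measure, lintegral_map (hG.indicator measurableSet_Icc)
            (measurable_mul_const y), smul_eq_mul]
      _ = ∫⁻ s in Ioi (0 : ℝ), (Iic y).indicator G s := by
          rw [lintegral_indicator measurableSet_Icc, lintegral_indicator measurableSet_Iic,
            Measure.restrict_restrict measurableSet_Iic, Iic_inter_Ioi]
          exact setLIntegral_congr Ioc_ae_eq_Icc.symm

/-- If `U` is standard uniform and independent of `Y ≥ 0`, then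
`E[Y G(UY)] = ∫₀^∞ P(Y ≥ s) G(s) ds`. -/
theorem lintegral_ofReal_mul_comp_uniform_mul {Ω : Type*} [MeasurableSpace Ω] (P : Measure Ω)
    [IsProbabilityMeasure P] {Y U : Ω → ℝ} (hY : Measurable Y) (hYnonneg : ∀ ω, 0 ≤ Y ω)
    (hU : Measurable U) (hUlaw : P.map U = volume.restrict (Icc (0 : ℝ) 1))
    (hUY : IndepFun U Y P) {G : ℝ → ℝ≥0∞} (hG : Measurable G) :
    ∫⁻ ω, ENNReal.ofReal (Y ω) * G (U ω * Y ω) ∂P =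
      ∫⁻ s in Ioi (0 : ℝ), P {ω | s ≤ Y ω} * G s := by
  have hprod := (indepFun_iff_map_prod_eq_prod_map_map hU.aemeasurable hY.aemeasurable).1 hUY
  have : IsProbabilityMeasure (P.map Y) := Measure.isProbabilityMeasure_map hY.aemeasurable
  have hmeas : Measurable fun p : ℝ × ℝ => ENNReal.ofReal p.2 * G (p.1 * p.2) := by fun_prop
  have hind : Measurable fun p : Ω × ℝ => (Iic (Y p.1)).indicator G p.2 := by
    have h : MeasurableSet {p : Ω × ℝ | p.2 ≤ Y p.1} :=
      measurableSet_le measurable_snd (hY.comp measurable_fst)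
    exact (hG.comp measurable_snd).indicator h
  calc ∫⁻ ω, ENNReal.ofReal (Y ω) * G (U ω * Y ω) ∂P
      = ∫⁻ p, ENNReal.ofReal p.2 * G (p.1 * p.2) ∂(P.map fun ω => (U ω, Y ω)) :=
        (lintegral_map hmeas (hU.prodMk hY)).symm
    _ = ∫⁻ y, (∫⁻ u in Icc (0 : ℝ) 1, ENNReal.ofReal y * G (u * y)) ∂(P.map Y) := by
        rw [hprod, hUlaw, lintegral_prod_symm' _ hmeas]
    _ = ∫⁻ ω, (∫⁻ u in Icc (0 : ℝ) 1, ENNReal.ofReal (Y ω) * G (u * Y ω)) ∂P :=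
        lintegral_map (hmeas.lintegral_prod_left') hY
    _ = ∫⁻ ω, (∫⁻ s in Ioi (0 : ℝ), (Iic (Y ω)).indicator G s) ∂P := by
        refine lintegral_congr fun ω => ?_
        rw [lintegral_const_mul _ (by fun_prop),
          ofReal_mul_lintegral_Icc_comp_mul hG (hYnonneg ω)]
    _ = ∫⁻ s in Ioi (0 : ℝ), ∫⁻ ω, (Iic (Y ω)).indicator G s ∂P :=
        lintegral_lintegral_swap hind.aemeasurable
    _ = ∫⁻ s in Ioi (0 : ℝ), P {ω | s ≤ Y ω} * G s := by
        refine lintegral_congr fun s => ?_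
        have h : (fun ω => (Iic (Y ω)).indicator G s) =
            {ω | s ≤ Y ω}.indicator fun _ => G s := by
          ext ω
          simp [indicator]
        rw [h, lintegral_indicator_const (measurableSet_le measurable_const hY), mul_comm]

theorem expMeasure_one_Ici {x : ℝ} (hx : 0 ≤ x) :
    expMeasure 1 (Ici x) = ENNReal.ofReal (Real.exp (-x)) := by
  have := isProbabilityMeasure_expMeasure (one_pos : (0 : ℝ) < 1)
  have hsing : expMeasure 1 {x} = 0 :=
    withDensity_absolutelyContinuous _ _ Real.volume_singleton
  have hcdf := cdf_expMeasure_eq (one_pos : (0 : ℝ) < 1) x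
  rw [cdf_eq_real, if_pos hx, one_mul] at hcdf
  have hIoi : (expMeasure 1).real (Ioi x) = Real.exp (-x) := by
    rw [← compl_Iic, probReal_compl_eq_one_sub measurableSet_Iic, hcdf, sub_sub_cancel]
  rw [← hIoi, ofReal_measureReal, ← Ioi_union_left,
    measure_union (by simp) (measurableSet_singleton x), hsing, add_zero]

/-- The path `1_{[s,∞)}` depends measurably on `s`. -/
theorem measurable_indicator_path :
    Measurable fun (s : ℝ) (t : ℝ≥0) => if s ≤ (t : ℝ) then (1 : ℝ≥0) else 0 :=
  measurable_pi_lambda _ fun _ =>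
    Measurable.ite measurableSet_Iic measurable_const measurable_const

/-- representation of the Lévy measure of the Poisson process with
intensity `λ`.  If `Y ≥ 0` has full support on `[0,∞)`, finite mean, and is independent
of the standard uniform `U`, and `h(x) = 1/P(Y ≥ x)`, then for every measurable
`F : [0,∞)^{[0,∞)} → [0,∞]` (paths indexed by `ℝ≥0` with values in `ℝ≥0`),
`λ ∫₀^∞ F(1_{[s,∞)}) ds = λ E[Y·h(UY)·F(1_{[UY,∞)})]`; in particular, when `Y` is
standard exponential, `λ ∫₀^∞ F(1_{[s,∞)}) ds = λ E[Y e^{UY} F(1_{[UY,∞)})]`. -/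
theorem poisson_levyMeasure_representation {Ω : Type*} [MeasurableSpace Ω] (P : Measure Ω)
    [IsProbabilityMeasure P] (lam : ℝ) (hlam : 0 < lam)
    (Y : Ω → ℝ) (hY : Measurable Y) (hYnonneg : ∀ ω, 0 ≤ Y ω)
    (hYsupp : ∀ x : ℝ, 0 ≤ x → 0 < P {ω | x ≤ Y ω})
    (hYint : Integrable Y P)
    (U : Ω → ℝ) (hU : Measurable U)
    (hUlaw : P.map U = volume.restrict (Set.Icc (0 : ℝ) 1))
    (hUY : IndepFun U Y P)
    (F : (ℝ≥0 → ℝ≥0) → ℝ≥0∞) (hF : Measurable F) :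
    (ENNReal.ofReal lam *
        ∫⁻ s in Set.Ioi (0 : ℝ), F (fun t => if s ≤ (t : ℝ) then 1 else 0) =
      ENNReal.ofReal lam *
        ∫⁻ ω, ENNReal.ofReal (Y ω) * (P {ω' | U ω * Y ω ≤ Y ω'})⁻¹ *
          F (fun t => if U ω * Y ω ≤ (t : ℝ) then 1 else 0) ∂P) ∧
    (P.map Y = expMeasure 1 →
      ENNReal.ofReal lam *
          ∫⁻ s in Set.Ioi (0 : ℝ), F (fun t => if s ≤ (t : ℝ) then 1 else 0) =
        ENNReal.ofReal lam *
          ∫⁻ ω, ENNReal.ofReal (Y ω * Real.exp (U ω * Y ω)) *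
            F (fun t => if U ω * Y ω ≤ (t : ℝ) then 1 else 0) ∂P) := by
  have hF' : Measurable fun s : ℝ => F (fun t => if s ≤ (t : ℝ) then 1 else 0) :=
    hF.comp measurable_indicator_path
  refine ⟨?_, fun hexp => ?_⟩
  · have htail : Measurable fun s : ℝ => P {ω | s ≤ Y ω} :=
      Antitone.measurable fun _ _ hst => measure_mono fun _ hω => hst.trans hω
    have key := lintegral_ofReal_mul_comp_uniform_mul P hY hYnonneg hU hUlaw hUY
      (htail.inv.mul hF')
    simp only [Pi.mul_apply, Pi.inv_apply, ← mul_assoc] at key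
    rw [key]
    congr 1
    refine setLIntegral_congr_fun measurableSet_Ioi fun s hs => ?_
    rw [ENNReal.mul_inv_cancel (hYsupp s (le_of_lt hs)).ne' (measure_ne_top _ _), one_mul]
  · have key := lintegral_ofReal_mul_comp_uniform_mul P hY hYnonneg hU hUlaw hUY
      (Real.measurable_exp.ennreal_ofReal.mul hF')
    simp only [Pi.mul_apply, ← mul_assoc, ← ENNReal.ofReal_mul (hYnonneg _)] at key
    rw [key]
    congr 1
    refine setLIntegral_congr_fun measurableSet_Ioi fun s hs => ?_
    have htail : P {ω | s ≤ Y ω} = ENNReal.ofReal (Real.exp (-s)) := by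
      rw [← expMeasure_one_Ici (le_of_lt hs), ← hexp, Measure.map_apply hY measurableSet_Ici]
      rfl
    rw [htail, ← ENNReal.ofReal_mul (Real.exp_nonneg _), ← Real.exp_add, neg_add_cancel,
      Real.exp_zero, ENNReal.ofReal_one, one_mul]
end

section
/- Let H > 0, let ρ be a σ-finite measure on (0,∞) with κ := ∫₀^∞ x ρ(dx) ∈ (0,∞), and let (ψ(t))_{t≥0} be a nonnegative stochastic process on a probability space (Ω, P) whose finite-dimensional Laplace transforms satisfy E[exp(−∑_{i=1}^n αᵢ ψ(tᵢ))] = exp(−∫_{−∞}^{∞} ∫₀^∞ (1 − exp(−∑_{i=1}^n αᵢ x e^{−s} 1_{[e^{−s/H},∞)}(tᵢ))) ρ(dx) ds) for all n ≥ 1, 0 ≤ t₁ < … < tₙ and α₁,…,αₙ ≥ 0. Let a > 0, let U be a standard uniform random variable and let V be a random variable with law κ^{−1} x ρ(dx) on (0,∞), with U and V independent. Then for all n, all 0 ≤ t₁ < … < tₙ and all α₁,…,αₙ ≥ 0: E[ψ(a) · exp(−∑_{i=1}^n αᵢ ψ(tᵢ))] = κ a^H · E[exp(−∑_{i=1}^n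 αᵢ ψ(tᵢ))] · E[exp(−a^H U V ∑_{i=1}^n αᵢ 1_{[aU^{1/H},∞)}(tᵢ))]. That is, adding the independent process r^{(a)}(t) = a^H U V 1_{[aU^{1/H},∞)}(t) to ψ reproduces the law of ψ under the size-biased measure (ψ(a)/(κa^H)) dP. -/
open MeasureTheory ProbabilityTheory Set
open scoped ENNReal NNReal
open Filter Topology

/-- A nonnegative combination of point evaluations can be rewritten over strictly increasing
nodes. -/
theorem exists_strictMono_sum_eq {ι : Type*} [Fintype ι] (t α : ι → ℝ)
    (ht : ∀ i, 0 ≤ t i) (hα : ∀ i, 0 ≤ α i) :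
    ∃ (m : ℕ) (t' α' : Fin m → ℝ), (∀ j, 0 ≤ t' j) ∧ StrictMono t' ∧ (∀ j, 0 ≤ α' j) ∧
      ∀ f : ℝ → ℝ, ∑ i, α i * f (t i) = ∑ j, α' j * f (t' j) := by
  classical
  set T : Finset ℝ := Finset.univ.image t with hT
  refine ⟨T.card, T.orderEmbOfFin rfl,
    fun j => ∑ i with t i = T.orderEmbOfFin rfl j, α i, fun j => ?_,
    (T.orderEmbOfFin rfl).strictMono, fun j => Finset.sum_nonneg fun i _ => hα i, fun f => ?_⟩
  · obtain ⟨i, -, hi⟩ := Finset.mem_image.mp (T.orderEmbOfFin_mem rfl j)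
    exact hi ▸ ht i
  · have h1 : ∑ j, (∑ i with t i = T.orderEmbOfFin rfl j, α i) * f (T.orderEmbOfFin rfl j) =
        ∑ τ ∈ T, (∑ i with t i = τ, α i) * f τ := by
      rw [← Finset.sum_coe_sort T (fun τ => (∑ i with t i = τ, α i) * f τ)]
      exact Fintype.sum_equiv (T.orderIsoOfFin rfl).toEquiv _ _ fun j => rfl
    rw [h1, ← Finset.sum_fiberwise_of_maps_to (g := t) (t := T)
      (fun i _ => Finset.mem_image_of_mem t (Finset.mem_univ i))]
    refine Finset.sum_congr rfl fun τ _ => ?_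
    rw [Finset.sum_mul]
    refine Finset.sum_congr rfl fun i hi => ?_
    rw [(Finset.mem_filter.mp hi).2]

theorem tendsto_one_sub_exp_neg_mul_div (x : ℝ) :
    Tendsto (fun ε : ℝ => (1 - Real.exp (-(ε * x))) / ε) (𝓝[>] 0) (𝓝 x) := by
  have h : HasDerivAt (fun ε : ℝ => 1 - Real.exp (-(ε * x))) x 0 := by
    have := (((hasDerivAt_id (0 : ℝ)).mul_const x).neg.exp).const_sub 1
    simpa using this
  have h2 := hasDerivWithinAt_iff_tendsto_slope.mp (h.hasDerivWithinAt (s := Ioi 0))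
  simp only [mem_Ioi, lt_irrefl, not_false_eq_true, sdiff_singleton_eq_self] at h2
  refine h2.congr fun ε => ?_
  simp [slope_def_field]

theorem one_sub_exp_neg_mul_div_mem_Icc {x ε : ℝ} (hx : 0 ≤ x) (hε : 0 < ε) :
    (1 - Real.exp (-(ε * x))) / ε ∈ Icc 0 x := by
  have h1 : Real.exp (-(ε * x)) ≤ 1 := Real.exp_le_one_iff.mpr (by simp; positivity)
  have h2 := Real.add_one_le_exp (-(ε * x))
  refine ⟨div_nonneg (by linarith) hε.le, ?_⟩
  rw [div_le_iff₀ hε]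
  linarith

theorem tendsto_integral_mul_one_sub_exp_div {S : Type*} [MeasurableSpace S] {μ : Measure S}
    {X Y : S → ℝ} (hX : Measurable X) (hY : Measurable Y)
    (hXi : Integrable (fun z => Real.exp (-Y z) * X z) μ) (hX0 : ∀ᵐ z ∂μ, 0 ≤ X z) :
    Tendsto (fun ε : ℝ => ∫ z, Real.exp (-Y z) * ((1 - Real.exp (-(ε * X z))) / ε) ∂μ)
      (𝓝[>] 0) (𝓝 (∫ z, Real.exp (-Y z) * X z ∂μ)) := by
  refine tendsto_integral_filter_of_dominated_convergence _ ?_ ?_ hXi ?_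
  · exact Eventually.of_forall fun ε => by fun_prop
  · filter_upwards [self_mem_nhdsWithin] with ε hε
    filter_upwards [hX0] with z hz
    obtain ⟨h1, h2⟩ := one_sub_exp_neg_mul_div_mem_Icc hz hε
    rw [Real.norm_of_nonneg (mul_nonneg (Real.exp_pos _).le h1)]
    gcongr
  · exact Eventually.of_forall fun z => (tendsto_one_sub_exp_neg_mul_div (X z)).const_mul _

/-- If the difference quotients of the Laplace transform at `0` converge, the limit is the
tilted first moment. -/
theorem integral_mul_exp_neg_eq_of_tendsto {Ω : Type*} [MeasurableSpace Ω] {P : Measure Ω}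
    [IsProbabilityMeasure P] {X Y : Ω → ℝ} (hX : Measurable X) (hY : Measurable Y)
    (hX0 : ∀ ω, 0 ≤ X ω) (hY0 : ∀ ω, 0 ≤ Y ω) {R : ℝ}
    (hR : Tendsto (fun ε : ℝ => ((∫ ω, Real.exp (-Y ω) ∂P) -
      ∫ ω, Real.exp (-(ε * X ω + Y ω)) ∂P) / ε) (𝓝[>] 0) (𝓝 R)) :
    ∫ ω, X ω * Real.exp (-Y ω) ∂P = R := by
  have hint : ∀ Z : Ω → ℝ, Measurable Z → (∀ ω, 0 ≤ Z ω) →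
      Integrable (fun ω => Real.exp (-Z ω)) P := fun Z hZ hZ0 => by
    refine Integrable.of_bound (C := 1) (by fun_prop) (Eventually.of_forall fun ω => ?_)
    rw [Real.norm_of_nonneg (Real.exp_pos _).le]
    exact Real.exp_le_one_iff.mpr (by simpa using hZ0 ω)
  have hpt : ∀ ε ω, Real.exp (-Y ω) * ((1 - Real.exp (-(ε * X ω))) / ε) =
      (Real.exp (-Y ω) - Real.exp (-(ε * X ω + Y ω))) / ε := fun ε ω => by
    rw [neg_add, Real.exp_add]
    ring
  have hintD : ∀ ε > 0, Integrable
      (fun ω => Real.exp (-Y ω) * ((1 - Real.exp (-(ε * X ω))) / ε)) P := fun ε hε => by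
    simp_rw [hpt]
    exact ((hint Y hY hY0).sub (hint (fun ω => ε * X ω + Y ω) (by fun_prop)
      fun ω => add_nonneg (mul_nonneg hε.le (hX0 ω)) (hY0 ω))).div_const ε
  have hR' : Tendsto (fun ε : ℝ => ∫ ω, Real.exp (-Y ω) * ((1 - Real.exp (-(ε * X ω))) / ε) ∂P)
      (𝓝[>] 0) (𝓝 R) := by
    refine hR.congr' ?_
    filter_upwards [self_mem_nhdsWithin] with ε hε
    simp_rw [hpt]
    rw [integral_div, integral_sub (hint Y hY hY0) (hint (fun ω => ε * X ω + Y ω) (by fun_prop)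
      fun ω => add_nonneg (mul_nonneg (le_of_lt hε) (hX0 ω)) (hY0 ω))]
  have hXi : Integrable (fun ω => Real.exp (-Y ω) * X ω) P := by
    obtain ⟨u, -, hu0, hu⟩ := exists_seq_strictAnti_tendsto' (zero_lt_one (α := ℝ))
    have hu' : Tendsto u atTop (𝓝[>] 0) :=
      tendsto_nhdsWithin_iff.mpr ⟨hu, Eventually.of_forall fun n => (hu0 n).1⟩
    refine ⟨by fun_prop, ?_⟩
    rw [hasFiniteIntegral_iff_ofReal
      (Eventually.of_forall fun ω => mul_nonneg (Real.exp_pos _).le (hX0 ω))]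
    have hlim : ∀ ω, liminf (fun n => ENNReal.ofReal
        (Real.exp (-Y ω) * ((1 - Real.exp (-(u n * X ω))) / u n))) atTop =
        ENNReal.ofReal (Real.exp (-Y ω) * X ω) := fun ω =>
      (ENNReal.tendsto_ofReal
        (((tendsto_one_sub_exp_neg_mul_div (X ω)).comp hu').const_mul _)).liminf_eq
    calc ∫⁻ ω, ENNReal.ofReal (Real.exp (-Y ω) * X ω) ∂P
        = ∫⁻ ω, liminf (fun n => ENNReal.ofReal
            (Real.exp (-Y ω) * ((1 - Real.exp (-(u n * X ω))) / u n))) atTop ∂P := by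
          simp_rw [hlim]
      _ ≤ liminf (fun n => ∫⁻ ω, ENNReal.ofReal
            (Real.exp (-Y ω) * ((1 - Real.exp (-(u n * X ω))) / u n)) ∂P) atTop :=
          lintegral_liminf_le fun n => by fun_prop
      _ = ENNReal.ofReal R := by
          refine Tendsto.liminf_eq ((ENNReal.tendsto_ofReal (hR'.comp hu')).congr fun n => ?_)
          exact ofReal_integral_eq_lintegral_ofReal (hintD _ (hu0 n).1)
            (Eventually.of_forall fun ω => mul_nonneg (Real.exp_pos _).le
              (one_sub_exp_neg_mul_div_mem_Icc (hX0 ω) (hu0 n).1).1)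
      _ < ∞ := ENNReal.ofReal_lt_top
  rw [← tendsto_nhds_unique
    (tendsto_integral_mul_one_sub_exp_div hX hY hXi (Eventually.of_forall hX0)) hR']
  simp_rw [mul_comm]

theorem integrable_one_sub_exp_neg {S : Type*} [MeasurableSpace S] {μ : Measure S} {Z : S → ℝ}
    (hZ : Integrable Z μ) (hZ0 : ∀ᵐ z ∂μ, 0 ≤ Z z) :
    Integrable (fun z => 1 - Real.exp (-Z z)) μ := by
  refine hZ.mono' ?_ ?_
  · exact aestronglyMeasurable_const.sub
      (Real.continuous_exp.comp_aestronglyMeasurable hZ.aestronglyMeasurable.neg)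
  · filter_upwards [hZ0] with z hz
    have h1 : Real.exp (-Z z) ≤ 1 := Real.exp_le_one_iff.mpr (by simpa using hz)
    have h2 := Real.add_one_le_exp (-Z z)
    rw [Real.norm_of_nonneg (by linarith)]
    linarith

theorem hasDerivWithinAt_integral_one_sub_exp {S : Type*} [MeasurableSpace S] {μ : Measure S}
    {X Y : S → ℝ} (hX : Measurable X) (hY : Measurable Y) (hXi : Integrable X μ)
    (hYi : Integrable Y μ) (hX0 : ∀ᵐ z ∂μ, 0 ≤ X z) (hY0 : ∀ᵐ z ∂μ, 0 ≤ Y z) :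
    HasDerivWithinAt (fun ε : ℝ => ∫ z, (1 - Real.exp (-(ε * X z + Y z))) ∂μ)
      (∫ z, Real.exp (-Y z) * X z ∂μ) (Ioi 0) 0 := by
  rw [hasDerivWithinAt_iff_tendsto_slope]
  simp only [mem_Ioi, lt_irrefl, not_false_eq_true, sdiff_singleton_eq_self]
  have hXi' : Integrable (fun z => Real.exp (-Y z) * X z) μ := by
    refine hXi.mono (by fun_prop) ?_
    filter_upwards [hY0] with z hz
    rw [norm_mul, Real.norm_of_nonneg (Real.exp_pos _).le]
    exact mul_le_of_le_one_left (norm_nonneg _) (Real.exp_le_one_iff.mpr (by simpa using hz))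
  refine (tendsto_integral_mul_one_sub_exp_div hX hY hXi' hX0).congr' ?_
  filter_upwards [self_mem_nhdsWithin] with ε hε
  have h1 : Integrable (fun z => 1 - Real.exp (-(ε * X z + Y z))) μ := by
    refine integrable_one_sub_exp_neg ((hXi.const_mul ε).add hYi) ?_
    filter_upwards [hX0, hY0] with z hz hz'
    exact add_nonneg (mul_nonneg (le_of_lt hε) hz) hz'
  have h0 : Integrable (fun z => 1 - Real.exp (-(0 * X z + Y z))) μ := by
    simpa using integrable_one_sub_exp_neg hYi hY0
  rw [slope_def_field, ← integral_sub h1 h0, ← integral_div]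
  refine integral_congr_ae (Eventually.of_forall fun z => ?_)
  simp only [zero_mul, zero_add, sub_zero, neg_add, Real.exp_add]
  ring

/-- The kernel `x e^{-s} 1_{[e^{-s/H},∞)}(b)` as a function of `(s, x)`. -/
noncomputable def satoKernel (H b : ℝ) (z : ℝ × ℝ) : ℝ :=
  z.2 * Real.exp (-z.1) * (if Real.exp (-z.1 / H) ≤ b then 1 else 0)

theorem measurable_satoKernel (H b : ℝ) : Measurable (satoKernel H b) := by
  unfold satoKernel
  refine Measurable.mul (by fun_prop) (Measurable.ite ?_ measurable_const measurable_const)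
  exact measurableSet_le (by fun_prop) measurable_const

theorem satoKernel_nonneg (H b : ℝ) {z : ℝ × ℝ} (hz : 0 < z.2) : 0 ≤ satoKernel H b z := by
  unfold satoKernel
  split_ifs <;> positivity

theorem ae_pos_of_measure_Iic_eq_zero {ρ : Measure ℝ} (hρ : ρ (Iic 0) = 0) :
    ∀ᵐ x ∂ρ, 0 < x := by
  rw [ae_iff]
  simp only [not_lt]
  exact hρ

theorem ae_prod_snd_pos {ρ : Measure ℝ} [SigmaFinite ρ] (hρ : ρ (Iic 0) = 0) :
    ∀ᵐ z ∂((volume : Measure ℝ).prod ρ), 0 < z.2 :=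
  Measure.quasiMeasurePreserving_snd.ae (ae_pos_of_measure_Iic_eq_zero hρ)

theorem integrable_satoKernel {H b : ℝ} (hH : 0 < H) (hb : 0 ≤ b) {ρ : Measure ℝ}
    [SigmaFinite ρ] (hρi : Integrable (fun x => x) ρ) :
    Integrable (satoKernel H b) ((volume : Measure ℝ).prod ρ) := by
  have h1 : Integrable
      (fun s : ℝ => Real.exp (-s) * (if Real.exp (-s / H) ≤ b then (1 : ℝ) else 0)) := by
    rcases hb.eq_or_lt with rfl | hb
    · simp [(Real.exp_pos _).not_ge]
    · have h2 : IntegrableOn (fun s : ℝ => Real.exp (-s)) (Ici (-(H * Real.log b))) := by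
        rw [integrableOn_Ici_iff_integrableOn_Ioi]
        simpa using exp_neg_integrableOn_Ioi (-(H * Real.log b)) one_pos
      refine (h2.integrable_indicator measurableSet_Ici).congr (Eventually.of_forall fun s => ?_)
      have h3 : Real.exp (-s / H) ≤ b ↔ s ∈ Ici (-(H * Real.log b)) := by
        rw [← Real.le_log_iff_exp_le hb, div_le_iff₀ hH, mem_Ici]
        constructor <;> intro h <;> linarith
      simp only [h3, indicator_apply, mul_ite, mul_one, mul_zero]
  refine (h1.mul_prod hρi).congr (Eventually.of_forall fun z => ?_)
  simp only [satoKernel]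
  ring

theorem lintegral_neg_exp_scaled {c : ℝ} (hc : 0 < c) (G : ℝ → ℝ≥0∞) :
    ∫⁻ u in Ioi 0, G u =
      ∫⁻ s : ℝ, ENNReal.ofReal (c⁻¹ * Real.exp (-s)) * G (c⁻¹ * Real.exp (-s)) := by
  have hd : ∀ s ∈ (univ : Set ℝ), HasDerivWithinAt (fun s => c⁻¹ * Real.exp (-s))
      (-(c⁻¹ * Real.exp (-s))) univ s := fun s _ => by
    have := ((hasDerivAt_id s).neg.exp.const_mul c⁻¹).hasDerivWithinAt (s := univ)
    simpa using this
  have hinj : InjOn (fun s : ℝ => c⁻¹ * Real.exp (-s)) univ := fun x _ y _ hxy => by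
    simpa [hc.ne'] using hxy
  have himg : (fun s : ℝ => c⁻¹ * Real.exp (-s)) '' univ = Ioi 0 := by
    ext u
    simp only [image_univ, mem_range, mem_Ioi]
    constructor
    · rintro ⟨s, rfl⟩
      positivity
    · intro hu
      refine ⟨-Real.log (c * u), ?_⟩
      rw [neg_neg, Real.exp_log (by positivity)]
      field_simp
  rw [← himg, lintegral_image_eq_lintegral_abs_deriv_mul MeasurableSet.univ hd hinj,
    setLIntegral_univ]
  refine lintegral_congr fun s => ?_
  rw [abs_neg, abs_of_nonneg (by positivity)]

theorem integral_exp_neg_mul_satoKernel {Ω : Type*} [MeasurableSpace Ω] {P : Measure Ω}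
    [IsProbabilityMeasure P] {H : ℝ} (hH : 0 < H) {ρ : Measure ℝ} [SigmaFinite ρ]
    (hρ : ρ (Iic 0) = 0) {κ : ℝ} (hκ : 0 < κ) {a : ℝ} (ha : 0 < a) {U V : Ω → ℝ}
    (hU : Measurable U) (hV : Measurable V)
    (hUlaw : P.map U = volume.restrict (Icc (0 : ℝ) 1))
    (hVlaw : P.map V = ρ.withDensity (fun x => ENNReal.ofReal (x / κ)))
    (hUV : IndepFun U V P) {ι : Type*} [Fintype ι] (t α : ι → ℝ) :
    ∫ z, Real.exp (-(∑ i, α i * satoKernel H (t i) z)) * satoKernel H a z ∂(volume.prod ρ) =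
      κ * a ^ H * ∫ ω, Real.exp (-(a ^ H * U ω * V ω *
        ∑ i, α i * (if a * U ω ^ (1 / H) ≤ t i then (1 : ℝ) else 0))) ∂P := by
  have hc : 0 < a ^ H := Real.rpow_pos_of_pos ha H
  set g : ℝ × ℝ → ℝ := fun z => Real.exp (-(a ^ H * z.1 * z.2 *
    ∑ i, α i * (if a * z.1 ^ (1 / H) ≤ t i then (1 : ℝ) else 0))) with hg
  have hgm : Measurable g := by
    refine Real.measurable_exp.comp (Measurable.neg (Measurable.mul (by fun_prop)
      (Finset.measurable_sum _ fun i _ => measurable_const.mul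
        (Measurable.ite ?_ measurable_const measurable_const))))
    exact measurableSet_le (by fun_prop) measurable_const
  have hKm : ∀ b, Measurable (satoKernel H b) := measurable_satoKernel H
  have hfac : ∀ s x : ℝ,
      ENNReal.ofReal (Real.exp (-(∑ i, α i * satoKernel H (t i) (s, x))) * satoKernel H a (s, x))
        = ENNReal.ofReal (κ * a ^ H) * (ENNReal.ofReal ((a ^ H)⁻¹ * Real.exp (-s)) *
          ((Iic 1).indicator 1 ((a ^ H)⁻¹ * Real.exp (-s)) *
            (ENNReal.ofReal (x / κ) * ENNReal.ofReal (g ((a ^ H)⁻¹ * Real.exp (-s), x))))) := by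
    intro s x
    have e1 : a ^ H * ((a ^ H)⁻¹ * Real.exp (-s)) = Real.exp (-s) := by field_simp
    have e2 : a * ((a ^ H)⁻¹ * Real.exp (-s)) ^ (1 / H) = Real.exp (-s / H) := by
      rw [Real.mul_rpow (by positivity) (Real.exp_pos _).le, Real.inv_rpow hc.le,
        ← Real.rpow_mul ha.le, ← Real.exp_mul, mul_one_div_cancel hH.ne', Real.rpow_one,
        mul_inv_cancel_left₀ ha.ne', mul_one_div]
    have e3 : (a ^ H)⁻¹ * Real.exp (-s) ∈ Iic 1 ↔ Real.exp (-s / H) ≤ a := by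
      rw [← e2, mem_Iic, mul_le_iff_le_one_right ha,
        Real.rpow_le_one_iff_of_pos (by positivity)]
      have : 0 < 1 / H := by positivity
      constructor
      · intro h
        exact Or.inr ⟨h, this.le⟩
      · rintro (⟨h, h'⟩ | ⟨h, -⟩)
        · linarith
        · exact h
    have e4 : g ((a ^ H)⁻¹ * Real.exp (-s), x) =
        Real.exp (-(∑ i, α i * satoKernel H (t i) (s, x))) := by
      simp only [hg, e1, e2, satoKernel, Finset.mul_sum]
      congr 2
      exact Finset.sum_congr rfl fun i _ => by ring
    rw [e4, indicator_apply]
    simp only [e3, satoKernel, Pi.one_apply]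
    split_ifs with h
    · rw [one_mul, ← ENNReal.ofReal_mul' (Real.exp_pos _).le,
        ← ENNReal.ofReal_mul (by positivity), ← ENNReal.ofReal_mul (by positivity)]
      congr 1
      generalize Real.exp (-(∑ i : ι, _)) = E
      field_simp
    · simp
  have hL : ∫⁻ z, ENNReal.ofReal
        (Real.exp (-(∑ i, α i * satoKernel H (t i) z)) * satoKernel H a z) ∂(volume.prod ρ) =
      ENNReal.ofReal (κ * a ^ H) * ∫⁻ u in Icc (0 : ℝ) 1,
        ∫⁻ x, ENNReal.ofReal (x / κ) * ENNReal.ofReal (g (u, x)) ∂ρ := by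
    rw [lintegral_prod _ (by fun_prop)]
    simp_rw [hfac]
    have hin : ∀ s : ℝ, ∫⁻ x, ENNReal.ofReal (κ * a ^ H) *
        (ENNReal.ofReal ((a ^ H)⁻¹ * Real.exp (-s)) *
          ((Iic 1).indicator 1 ((a ^ H)⁻¹ * Real.exp (-s)) * (ENNReal.ofReal (x / κ) *
            ENNReal.ofReal (g ((a ^ H)⁻¹ * Real.exp (-s), x))))) ∂ρ =
        ENNReal.ofReal (κ * a ^ H) * (ENNReal.ofReal ((a ^ H)⁻¹ * Real.exp (-s)) *
          (Iic 1).indicator (fun u => ∫⁻ x, ENNReal.ofReal (x / κ) * ENNReal.ofReal (g (u, x)) ∂ρ)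
            ((a ^ H)⁻¹ * Real.exp (-s))) := fun s => by
      rw [lintegral_const_mul' _ _ ENNReal.ofReal_ne_top,
        lintegral_const_mul' _ _ ENNReal.ofReal_ne_top,
        lintegral_const_mul' _ _ (by rw [indicator_apply]; split_ifs <;> simp)]
      simp only [indicator_apply]
      split_ifs <;> simp
    simp_rw [hin]
    rw [lintegral_const_mul' _ _ ENNReal.ofReal_ne_top, ← lintegral_neg_exp_scaled hc,
      setLIntegral_indicator measurableSet_Iic, Iic_inter_Ioi, setLIntegral_congr Ioc_ae_eq_Icc]
  have hR : ∫⁻ ω, ENNReal.ofReal (g (U ω, V ω)) ∂P =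
      ∫⁻ u in Icc (0 : ℝ) 1, ∫⁻ x, ENNReal.ofReal (x / κ) * ENNReal.ofReal (g (u, x)) ∂ρ := by
    have : SFinite (ρ.withDensity fun x => ENNReal.ofReal (x / κ)) := hVlaw ▸ inferInstance
    rw [← lintegral_map (f := fun z => ENNReal.ofReal (g z)) (by fun_prop) (hU.prodMk hV),
      (indepFun_iff_map_prod_eq_prod_map_map hU.aemeasurable hV.aemeasurable).mp hUV,
      hUlaw, hVlaw, lintegral_prod _ (by fun_prop)]
    refine lintegral_congr fun u => ?_
    rw [lintegral_withDensity_eq_lintegral_mul _ (by fun_prop) (by fun_prop)]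
    rfl
  rw [integral_eq_lintegral_of_nonneg_ae _ (by fun_prop), hL, ← hR, ENNReal.toReal_mul,
    ENNReal.toReal_ofReal (by positivity),
    integral_eq_lintegral_of_nonneg_ae (Eventually.of_forall fun ω => (Real.exp_pos _).le)
      (hgm.comp (hU.prodMk hV)).aestronglyMeasurable]
  filter_upwards [ae_prod_snd_pos hρ] with z hz
  exact mul_nonneg (Real.exp_pos _).le (satoKernel_nonneg H a hz)

theorem laplace_eq_exp_neg_integral_satoKernel {Ω : Type*} [MeasurableSpace Ω] {P : Measure Ω}
    {H : ℝ} {ρ : Measure ℝ} [SigmaFinite ρ] (hρ : ρ (Iic 0) = 0) {ψ : ℝ → Ω → ℝ}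
    (hLaplace : ∀ (n : ℕ) (t α : Fin n → ℝ),
      (∀ i, 0 ≤ t i) → StrictMono t → (∀ i, 0 ≤ α i) →
      ∫ ω, Real.exp (-(∑ i, α i * ψ (t i) ω)) ∂P =
        Real.exp (-(∫⁻ s : ℝ, ∫⁻ x, ENNReal.ofReal
          (1 - Real.exp (-(∑ i, α i * (x * Real.exp (-s) *
            (if Real.exp (-s / H) ≤ t i then 1 else 0))))) ∂ρ).toReal))
    {ι : Type*} [Fintype ι] (t α : ι → ℝ) (ht : ∀ i, 0 ≤ t i) (hα : ∀ i, 0 ≤ α i) :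
    ∫ ω, Real.exp (-(∑ i, α i * ψ (t i) ω)) ∂P =
      Real.exp (-∫ z, (1 - Real.exp (-(∑ i, α i * satoKernel H (t i) z))) ∂(volume.prod ρ)) := by
  have hKm : ∀ b, Measurable (satoKernel H b) := measurable_satoKernel H
  obtain ⟨m, t', α', ht', hmono, hα', hsum⟩ := exists_strictMono_sum_eq t α ht hα
  have h1 : ∀ ω, ∑ i, α i * ψ (t i) ω = ∑ j, α' j * ψ (t' j) ω := fun ω => hsum fun b => ψ b ω
  have h2 : ∀ z, ∑ i, α i * satoKernel H (t i) z = ∑ j, α' j * satoKernel H (t' j) z :=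
    fun z => hsum fun b => satoKernel H b z
  simp_rw [h1, h2]
  rw [hLaplace m t' α' ht' hmono hα', integral_eq_lintegral_of_nonneg_ae _ (by fun_prop),
    lintegral_prod _ (by fun_prop)]
  · rfl
  · filter_upwards [ae_prod_snd_pos hρ] with z hz
    have : 0 ≤ ∑ j, α' j * satoKernel H (t' j) z :=
      Finset.sum_nonneg fun j _ => mul_nonneg (hα' j) (satoKernel_nonneg H _ hz)
    simpa using this

/-- for a nonnegative `H`-self-similar Sato process `ψ` with driving Lévy
measure `ρ` on `(0,∞)` with `κ = ∫ x ρ(dx) ∈ (0,∞)`, and independent `U` uniform on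
`[0,1]` and `V ~ κ⁻¹ x ρ(dx)`, adding the independent process
`r^{(a)}(t) = a^H U V 1_{[aU^{1/H},∞)}(t)` to `ψ` reproduces the law of `ψ` under the
size-biased measure `(ψ(a)/(κ a^H)) dP`, expressed through Laplace transforms. -/
theorem sato_size_biased_identity {Ω : Type*} [MeasurableSpace Ω] (P : Measure Ω)
    [IsProbabilityMeasure P] (H : ℝ) (hH : 0 < H)
    (ρ : Measure ℝ) [SigmaFinite ρ] (hρsupp : ρ (Set.Iic 0) = 0)
    (κ : ℝ) (hκ : 0 < κ) (hκρ : ∫⁻ x, ENNReal.ofReal x ∂ρ = ENNReal.ofReal κ)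
    (ψ : ℝ → Ω → ℝ) (hψmeas : ∀ t, Measurable (ψ t)) (hψnonneg : ∀ t ω, 0 ≤ ψ t ω)
    (hLaplace : ∀ (n : ℕ) (t α : Fin n → ℝ),
      (∀ i, 0 ≤ t i) → StrictMono t → (∀ i, 0 ≤ α i) →
      ∫ ω, Real.exp (-(∑ i, α i * ψ (t i) ω)) ∂P =
        Real.exp (-(∫⁻ s : ℝ, ∫⁻ x, ENNReal.ofReal
          (1 - Real.exp (-(∑ i, α i * (x * Real.exp (-s) *
            (if Real.exp (-s / H) ≤ t i then 1 else 0))))) ∂ρ).toReal))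
    (a : ℝ) (ha : 0 < a)
    (U V : Ω → ℝ) (hU : Measurable U) (hV : Measurable V)
    (hUlaw : P.map U = volume.restrict (Set.Icc (0 : ℝ) 1))
    (hVlaw : P.map V = ρ.withDensity (fun x => ENNReal.ofReal (x / κ)))
    (hUV : IndepFun U V P)
    (n : ℕ) (t α : Fin n → ℝ)
    (ht0 : ∀ i, 0 ≤ t i) (htmono : StrictMono t) (hα : ∀ i, 0 ≤ α i) :
    ∫ ω, ψ a ω * Real.exp (-(∑ i, α i * ψ (t i) ω)) ∂P =
      κ * a ^ H * (∫ ω, Real.exp (-(∑ i, α i * ψ (t i) ω)) ∂P) *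
        ∫ ω, Real.exp (-(a ^ H * U ω * V ω *
          ∑ i, α i * (if a * U ω ^ (1 / H) ≤ t i then (1 : ℝ) else 0))) ∂P := by
  have hKm : ∀ b, Measurable (satoKernel H b) := measurable_satoKernel H
  have hρpos : ∀ᵐ x ∂ρ, 0 ≤ x :=
    (ae_pos_of_measure_Iic_eq_zero hρsupp).mono fun x hx => hx.le
  have hρi : Integrable (fun x => x) ρ := by
    refine ⟨by fun_prop, ?_⟩
    rw [hasFiniteIntegral_iff_ofReal hρpos, hκρ]
    exact ENNReal.ofReal_lt_top
  have hLap : ∀ ε : ℝ, 0 ≤ ε →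
      ∫ ω, Real.exp (-(ε * ψ a ω + ∑ i, α i * ψ (t i) ω)) ∂P =
        Real.exp (-∫ z, (1 - Real.exp (-(ε * satoKernel H a z +
          ∑ i, α i * satoKernel H (t i) z))) ∂(volume.prod ρ)) := fun ε hε => by
    have h := laplace_eq_exp_neg_integral_satoKernel hρsupp hLaplace
      (Fin.cons a t : Fin (n + 1) → ℝ) (Fin.cons ε α)
      (Fin.cases (by simpa using ha.le) (by simpa using ht0))
      (Fin.cases (by simpa using hε) (by simpa using hα))
    simpa only [Fin.sum_univ_succ, Fin.cons_zero, Fin.cons_succ] using h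
  have hK0 : ∀ b, ∀ᵐ z ∂((volume : Measure ℝ).prod ρ), 0 ≤ satoKernel H b z := fun b => by
    filter_upwards [ae_prod_snd_pos hρsupp] with z hz
    exact satoKernel_nonneg H b hz
  have hderiv := (hasDerivWithinAt_integral_one_sub_exp (hKm a)
    (Y := fun z => ∑ i, α i * satoKernel H (t i) z) (by fun_prop)
    (integrable_satoKernel hH ha.le hρi)
    (integrable_finsetSum _ fun i _ => (integrable_satoKernel hH (ht0 i) hρi).const_mul (α i))
    (hK0 a) (by
      filter_upwards [ae_prod_snd_pos hρsupp] with z hz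
      exact Finset.sum_nonneg fun i _ => mul_nonneg (hα i) (satoKernel_nonneg H _ hz))).neg.exp
  rw [hasDerivWithinAt_iff_tendsto_slope] at hderiv
  simp only [mem_Ioi, lt_irrefl, not_false_eq_true, sdiff_singleton_eq_self] at hderiv
  have hLap0 := hLap 0 le_rfl
  simp only [zero_mul, zero_add] at hLap0
  refine integral_mul_exp_neg_eq_of_tendsto (hψmeas a)
    (Y := fun ω => ∑ i, α i * ψ (t i) ω) (by fun_prop) (hψnonneg a)
    (fun ω => Finset.sum_nonneg fun i _ => mul_nonneg (hα i) (hψnonneg _ ω)) ?_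
  convert hderiv.neg.congr' ?_ using 2
  · rw [integral_exp_neg_mul_satoKernel hH hρsupp hκ ha hU hV hUlaw hVlaw hUV]
    simp only [Pi.neg_apply, zero_mul, zero_add]
    rw [← hLap0]
    ring
  · filter_upwards [self_mem_nhdsWithin] with ε hε
    rw [hLap ε (le_of_lt hε), hLap0, slope_def_field]
    simp only [Pi.neg_apply, zero_mul, zero_add, sub_zero]
    ring
end

section
/- Let f : ℝ → [0,∞) be measurable with f(u) = 0 for u < 0 and ∫₀^t f(s) ds < ∞ for every t > 0, and set I(a) = ∫₀^a f(s) ds. Let ρ be a σ-finite measure on (0,∞) with κ := ∫₀^∞ x ρ(dx) ∈ (0,∞). Let (ψ(t))_{t≥0} be a nonnegative stochastic process on a probability space (Ω, P) such that E[exp(−∑_{i=1}^n αᵢ ψ(tᵢ))] = exp(−∫₀^∞ ∫₀^∞ (1 − exp(−∑_{i=1}^n αᵢ x f(tᵢ − s))) ρ(dx) ds) for all n ≥ 1, 0 ≤ t₁ < … < tₙ and α₁,…,αₙ ≥ 0. Fix a > 0 with I(a) > 0, let U_a be a random variable with density f(a−s)/I(a) on [0,a], and let V be a random variable with law κ^{−1}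 x ρ(dx) on (0,∞), with U_a and V independent. Then for all n, all 0 ≤ t₁ < … < tₙ and all α₁,…,αₙ ≥ 0: E[ψ(a) · exp(−∑_{i=1}^n αᵢ ψ(tᵢ))] = κ I(a) · E[exp(−∑_{i=1}^n αᵢ ψ(tᵢ))] · E[exp(−V ∑_{i=1}^n αᵢ f(tᵢ − U_a))]. That is, adding the independent process r^{(a)}(t) = V f(t − U_a) to ψ reproduces the law of ψ under the size-biased measure (ψ(a)/(κ I(a))) dP. -/
open MeasureTheory ProbabilityTheory Set
open scoped ENNReal NNReal

open Filter Topology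

/-- If `φ → 0` and `φ / θ → K`, then `(1 - exp (-φ)) / θ → K`. -/
lemma tendsto_one_sub_exp_neg_div {ι : Type*} {l : Filter ι} {φ θ : ι → ℝ} {K : ℝ}
    (hφ : Tendsto φ l (𝓝 0)) (hK : Tendsto (fun k => φ k / θ k) l (𝓝 K)) :
    Tendsto (fun k => (1 - Real.exp (-φ k)) / θ k) l (𝓝 K) := by
  have hd : HasDerivAt (fun u : ℝ => 1 - Real.exp (-u)) 1 0 := by
    simpa using ((hasDerivAt_id (0 : ℝ)).neg.exp).const_sub 1
  have hc : ContinuousAt (dslope (fun u : ℝ => 1 - Real.exp (-u)) 0) 0 :=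
    continuousAt_dslope_same.2 hd.differentiableAt
  have h1 : Tendsto (fun k => dslope (fun u : ℝ => 1 - Real.exp (-u)) 0 (φ k)) l (𝓝 1) := by
    have := hc.tendsto.comp hφ
    rwa [dslope_same, hd.deriv] at this
  have h2 := hK.mul h1
  rw [mul_one] at h2
  refine h2.congr fun k => ?_
  have := sub_smul_dslope (fun u : ℝ => 1 - Real.exp (-u)) 0 (φ k)
  simp only [sub_zero, smul_eq_mul, neg_zero, Real.exp_zero, sub_self] at this
  rw [← this]
  ring

lemma tendsto_half_pow : Tendsto (fun k : ℕ => (1 / 2 : ℝ) ^ k) atTop (𝓝 0) :=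
  tendsto_pow_atTop_nhds_zero_of_lt_one (by norm_num) (by norm_num)

lemma tendsto_one_sub_exp_neg_half_pow_mul_div (y : ℝ) :
    Tendsto (fun k : ℕ => (1 - Real.exp (-((1 / 2 : ℝ) ^ k * y))) / (1 / 2 : ℝ) ^ k)
      atTop (𝓝 y) := by
  refine tendsto_one_sub_exp_neg_div (by simpa using tendsto_half_pow.mul_const y) ?_
  refine tendsto_const_nhds.congr fun k => ?_
  field_simp

lemma monotone_one_sub_exp_neg_half_pow_mul_div (y : ℝ) :
    Monotone (fun k : ℕ => (1 - Real.exp (-((1 / 2 : ℝ) ^ k * y))) / (1 / 2 : ℝ) ^ k) := by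
  refine monotone_nat_of_le_succ fun k => ?_
  have hp : (0 : ℝ) < (1 / 2 : ℝ) ^ k := by positivity
  have he : Real.exp (-((1 / 2 : ℝ) ^ k * y)) = Real.exp (-((1 / 2 : ℝ) ^ (k + 1) * y)) ^ 2 := by
    rw [← Real.exp_nat_mul]
    congr 1
    rw [pow_succ]
    push_cast
    ring
  rw [he, pow_succ, div_le_div_iff₀ hp (by positivity)]
  nlinarith [mul_nonneg hp.le (sq_nonneg (1 - Real.exp (-((1 / 2 : ℝ) ^ (k + 1) * y)))),
    pow_succ (1 / 2 : ℝ) k]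

/-- The right derivative at `0` of the Laplace transform of `Y` under `exp (-X) dP`. -/
lemma integral_mul_exp_neg_of_tendsto {Ω : Type*} [MeasurableSpace Ω] (P : Measure Ω)
    [IsProbabilityMeasure P] {X Y : Ω → ℝ} (hX : Measurable X) (hY : Measurable Y)
    (hX0 : ∀ ω, 0 ≤ X ω) (hY0 : ∀ ω, 0 ≤ Y ω) {L : ℝ}
    (hL : Tendsto (fun k : ℕ => (∫ ω, Real.exp (-X ω) ∂P -
      ∫ ω, Real.exp (-((1 / 2 : ℝ) ^ k * Y ω + X ω)) ∂P) / (1 / 2 : ℝ) ^ k) atTop (𝓝 L)) :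
    ∫ ω, Y ω * Real.exp (-X ω) ∂P = L := by
  set h : ℕ → Ω → ℝ := fun k ω =>
    Real.exp (-X ω) * ((1 - Real.exp (-((1 / 2 : ℝ) ^ k * Y ω))) / (1 / 2 : ℝ) ^ k) with hh
  have hint : ∀ Z : Ω → ℝ, Measurable Z → (∀ ω, 0 ≤ Z ω) →
      Integrable (fun ω => Real.exp (-Z ω)) P := fun Z hZ hZ0 => by
    refine Integrable.of_bound (by fun_prop) 1 (Eventually.of_forall fun ω => ?_)
    rw [Real.norm_of_nonneg (Real.exp_nonneg _), Real.exp_le_one_iff]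
    linarith [hZ0 ω]
  have hkeq : ∀ k, h k = fun ω => (Real.exp (-X ω) -
      Real.exp (-((1 / 2 : ℝ) ^ k * Y ω + X ω))) / (1 / 2 : ℝ) ^ k := fun k => by
    ext ω
    simp only [hh]
    rw [neg_add, Real.exp_add]
    ring
  have hi1 := hint X hX hX0
  have hi2 : ∀ k : ℕ, Integrable (fun ω => Real.exp (-((1 / 2 : ℝ) ^ k * Y ω + X ω))) P :=
    fun k => hint _ (by fun_prop) fun ω => by have := hX0 ω; have := hY0 ω; positivity
  have hki : ∀ k, Integrable (h k) P := fun k => by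
    rw [hkeq]
    exact (hi1.sub (hi2 k)).div_const _
  have hk0 : ∀ k ω, 0 ≤ h k ω := fun k ω => by
    refine mul_nonneg (Real.exp_nonneg _) (div_nonneg ?_ (by positivity))
    rw [sub_nonneg, Real.exp_le_one_iff, neg_nonpos]
    exact mul_nonneg (by positivity) (hY0 ω)
  have hkv : ∀ k, ∫ ω, h k ω ∂P = (∫ ω, Real.exp (-X ω) ∂P -
      ∫ ω, Real.exp (-((1 / 2 : ℝ) ^ k * Y ω + X ω)) ∂P) / (1 / 2 : ℝ) ^ k := fun k => by
    rw [hkeq, integral_div, integral_sub hi1 (hi2 k)]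
  have hL0 : 0 ≤ L := ge_of_tendsto' hL fun k => by
    rw [← hkv]
    exact integral_nonneg (hk0 k)
  have hlim := lintegral_tendsto_of_tendsto_of_monotone (μ := P)
    (f := fun k ω => ENNReal.ofReal (h k ω))
    (F := fun ω => ENNReal.ofReal (Y ω * Real.exp (-X ω)))
    (fun k => (hki k).aemeasurable.ennreal_ofReal)
    (Eventually.of_forall fun ω k l hkl => ENNReal.ofReal_le_ofReal
      (mul_le_mul_of_nonneg_left (monotone_one_sub_exp_neg_half_pow_mul_div (Y ω) hkl)
        (Real.exp_nonneg _)))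
    (Eventually.of_forall fun ω => ENNReal.tendsto_ofReal (by
      rw [mul_comm]
      exact (tendsto_one_sub_exp_neg_half_pow_mul_div (Y ω)).const_mul _))
  have hlim' : Tendsto (fun k => ∫⁻ ω, ENNReal.ofReal (h k ω) ∂P) atTop
      (𝓝 (ENNReal.ofReal L)) := by
    refine (ENNReal.tendsto_ofReal hL).congr fun k => ?_
    rw [← hkv, ofReal_integral_eq_lintegral_ofReal (hki k) (Eventually.of_forall (hk0 k))]
  rw [integral_eq_lintegral_of_nonneg_ae
    (Eventually.of_forall fun ω => mul_nonneg (hY0 ω) (Real.exp_nonneg _)) (by fun_prop),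
    tendsto_nhds_unique hlim hlim', ENNReal.toReal_ofReal hL0]

lemma integrable_one_sub_exp_neg_s11 {E : Type*} [MeasurableSpace E] {m : Measure E} {G : E → ℝ}
    (hG : Integrable G m) (hG0 : ∀ᵐ z ∂m, 0 ≤ G z) :
    Integrable (fun z => 1 - Real.exp (-G z)) m := by
  refine hG.mono (by fun_prop) ?_
  filter_upwards [hG0] with z hz
  have h1 : Real.exp (-G z) ≤ 1 := by rw [Real.exp_le_one_iff]; linarith
  rw [Real.norm_of_nonneg (by linarith), Real.norm_of_nonneg hz]
  linarith [Real.add_one_le_exp (-G z)]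

/-- The right derivative at `θ = 0` of the Laplace exponent `∫ (1 - exp (-(θ H + G)))`. -/
lemma tendsto_integral_one_sub_exp_neg_slope {E : Type*} [MeasurableSpace E] {m : Measure E}
    {G H : E → ℝ} (hG : Integrable G m) (hH : Integrable H m)
    (hG0 : ∀ᵐ z ∂m, 0 ≤ G z) (hH0 : ∀ᵐ z ∂m, 0 ≤ H z) :
    Tendsto (fun k : ℕ => (∫ z, (1 - Real.exp (-((1 / 2 : ℝ) ^ k * H z + G z))) ∂m -
      ∫ z, (1 - Real.exp (-G z)) ∂m) / (1 / 2 : ℝ) ^ k) atTop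
      (𝓝 (∫ z, H z * Real.exp (-G z) ∂m)) := by
  have hi : ∀ k : ℕ, Integrable (fun z => 1 - Real.exp (-((1 / 2 : ℝ) ^ k * H z + G z))) m :=
    fun k => integrable_one_sub_exp_neg_s11 ((hH.const_mul _).add hG) (by
      filter_upwards [hG0, hH0] with z h1 h2
      positivity)
  have hi0 := integrable_one_sub_exp_neg_s11 hG hG0
  have key := tendsto_integral_of_dominated_convergence (μ := m)
    (F := fun (k : ℕ) z => Real.exp (-G z) *
      ((1 - Real.exp (-((1 / 2 : ℝ) ^ k * H z))) / (1 / 2 : ℝ) ^ k))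
    (f := fun z => H z * Real.exp (-G z)) H
    (fun k => by fun_prop) hH
    (fun k => by
      filter_upwards [hG0, hH0] with z h1 h2
      have hp : (0 : ℝ) < (1 / 2 : ℝ) ^ k := by positivity
      have h3 : Real.exp (-G z) ≤ 1 := by rw [Real.exp_le_one_iff]; linarith
      have h4 : Real.exp (-((1 / 2 : ℝ) ^ k * H z)) ≤ 1 := by
        rw [Real.exp_le_one_iff, neg_nonpos]; positivity
      have h5 : 0 ≤ (1 - Real.exp (-((1 / 2 : ℝ) ^ k * H z))) / (1 / 2 : ℝ) ^ k :=
        div_nonneg (by linarith) hp.le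
      rw [Real.norm_of_nonneg (mul_nonneg (Real.exp_nonneg _) h5)]
      refine (mul_le_of_le_one_left h5 h3).trans ?_
      rw [div_le_iff₀ hp]
      linarith [Real.add_one_le_exp (-((1 / 2 : ℝ) ^ k * H z))])
    (Eventually.of_forall fun z => by
      rw [mul_comm]
      exact (tendsto_one_sub_exp_neg_half_pow_mul_div (H z)).const_mul _)
  refine key.congr fun k => ?_
  rw [← integral_sub (hi k) hi0, ← integral_div]
  refine integral_congr_ae (Eventually.of_forall fun z => ?_)
  simp only
  rw [neg_add, Real.exp_add]
  ring

/-- Differentiating a Laplace transform of the form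
`E exp (-(θ Y + X)) = exp (-∫ (1 - exp (-(θ H + G))))` at `θ = 0`. -/
lemma integral_mul_exp_neg_of_laplace {Ω E : Type*} [MeasurableSpace Ω] [MeasurableSpace E]
    (P : Measure Ω) [IsProbabilityMeasure P] {m : Measure E} {X Y : Ω → ℝ} {G H : E → ℝ}
    (hX : Measurable X) (hY : Measurable Y) (hX0 : ∀ ω, 0 ≤ X ω) (hY0 : ∀ ω, 0 ≤ Y ω)
    (hG : Integrable G m) (hH : Integrable H m)
    (hG0 : ∀ᵐ z ∂m, 0 ≤ G z) (hH0 : ∀ᵐ z ∂m, 0 ≤ H z)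
    (hL : ∀ θ : ℝ, 0 ≤ θ → ∫ ω, Real.exp (-(θ * Y ω + X ω)) ∂P =
      Real.exp (-∫ z, (1 - Real.exp (-(θ * H z + G z))) ∂m)) :
    ∫ ω, Y ω * Real.exp (-X ω) ∂P =
      (∫ ω, Real.exp (-X ω) ∂P) * ∫ z, H z * Real.exp (-G z) ∂m := by
  refine integral_mul_exp_neg_of_tendsto P hX hY hX0 hY0 ?_
  have hs := tendsto_integral_one_sub_exp_neg_slope hG hH hG0 hH0
  have h0 : ∫ ω, Real.exp (-X ω) ∂P = Real.exp (-∫ z, (1 - Real.exp (-G z)) ∂m) := by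
    simpa using hL 0 le_rfl
  have hz := hs.mul tendsto_half_pow
  rw [mul_zero] at hz
  have hz' := hz.congr fun k => div_mul_cancel₀ _ (by positivity)
  refine ((tendsto_one_sub_exp_neg_div hz' hs).const_mul _).congr fun k => ?_
  rw [hL _ (by positivity), h0, ← mul_div_assoc, mul_sub, mul_one, ← Real.exp_add]
  congr 4
  ring

/-- A locally integrable causal kernel, reflected at `t ≥ 0`, is integrable on `(0, ∞)`. -/
lemma integrableOn_comp_sub_left_of_causal {f : ℝ → ℝ} (hfneg : ∀ u, u < 0 → f u = 0)
    (hfint : ∀ t : ℝ, 0 < t → IntegrableOn f (Set.Ioc 0 t) volume) {t : ℝ} (ht : 0 ≤ t) :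
    IntegrableOn (fun s => f (t - s)) (Set.Ioi 0) volume := by
  have h1 : IntegrableOn f (Set.Iio t) volume := by
    have hn : IntegrableOn f (Set.Iio 0) volume :=
      integrableOn_zero.congr_fun (fun u hu => (hfneg u hu).symm) measurableSet_Iio
    have h0 : IntegrableOn f ({0} : Set ℝ) volume :=
      integrableOn_singleton (hx := by simp)
    have hp : IntegrableOn f (Set.Ioc 0 (t + 1)) volume := hfint _ (by linarith)
    refine ((hn.union h0).union hp).mono_set fun u hu => ?_
    rcases lt_trichotomy u 0 with h | h | h
    · exact Or.inl (Or.inl h)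
    · exact Or.inl (Or.inr h)
    · exact Or.inr ⟨h, by have := mem_Iio.1 hu; linarith⟩
  have h2 := ((volume.measurePreserving_sub_left t).integrableOn_comp_preimage
    (MeasurableEquiv.subLeft t).measurableEmbedding).2 h1
  simpa [Function.comp_def] using h2

lemma sum_insert_image_collect {n : ℕ} (t α : Fin n → ℝ) (a θ : ℝ) (q : ℝ → ℝ) :
    ∑ r ∈ insert a (Finset.univ.image t),
      ((if r = a then θ else 0) + ∑ i, if t i = r then α i else 0) * q r =
      θ * q a + ∑ i, α i * q (t i) := by
  simp only [add_mul, Finset.sum_add_distrib, Finset.sum_mul]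
  congr 1
  · simp [ite_mul]
  · rw [Finset.sum_comm]
    refine Finset.sum_congr rfl fun i _ => ?_
    simp [ite_mul]

/-- Integrals against the law of an independent pair `(U, V)` whose marginals have real
densities `p`, `q` with respect to `μ`, `ν`. -/
lemma IndepFun.integral_comp_withDensity {Ω E F : Type*} [MeasurableSpace Ω] [MeasurableSpace E]
    [MeasurableSpace F] {P : Measure Ω} [IsFiniteMeasure P] {μ : Measure E} {ν : Measure F}
    [SFinite μ] [SFinite ν] {U : Ω → E} {V : Ω → F} (hU : Measurable U) (hV : Measurable V)
    (hUV : IndepFun U V P) {p : E → ℝ} {q : F → ℝ} (hp : Measurable p) (hq : Measurable q)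
    (hUlaw : P.map U = μ.withDensity fun u => ENNReal.ofReal (p u))
    (hVlaw : P.map V = ν.withDensity fun v => ENNReal.ofReal (q v))
    (hp0 : ∀ᵐ u ∂μ, 0 ≤ p u) (hq0 : ∀ᵐ v ∂ν, 0 ≤ q v)
    {h : E × F → ℝ} (hh : Measurable h) :
    ∫ ω, h (U ω, V ω) ∂P = ∫ z, p z.1 * q z.2 * h z ∂(μ.prod ν) := by
  have hlaw : P.map (fun ω => (U ω, V ω)) =
      (μ.prod ν).withDensity fun z => ENNReal.ofReal (p z.1) * ENNReal.ofReal (q z.2) := by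
    rw [hUV.map_prod_eq_prod_map_map hU.aemeasurable hV.aemeasurable, hUlaw, hVlaw,
      prod_withDensity (by fun_prop) (by fun_prop)]
  rw [← integral_map (φ := fun ω => (U ω, V ω)) (by fun_prop) hh.aestronglyMeasurable, hlaw,
    integral_withDensity_eq_integral_toReal_smul (by fun_prop)
      (Eventually.of_forall fun z => ENNReal.mul_lt_top ENNReal.ofReal_lt_top
        ENNReal.ofReal_lt_top)]
  refine integral_congr_ae ?_
  filter_upwards [Measure.quasiMeasurePreserving_fst.ae hp0,
    Measure.quasiMeasurePreserving_snd.ae hq0] with z h1 h2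
  rw [ENNReal.toReal_mul, ENNReal.toReal_ofReal h1, ENNReal.toReal_ofReal h2, smul_eq_mul]


/-- for the stochastic convolution `ψ(t) = ∫₀^t f(t−s) dZ_s` of a
nonnegative kernel `f` with a driftless subordinator with Lévy measure `ρ`
(`κ = ∫ x ρ(dx) ∈ (0,∞)`, `I(a) = ∫₀^a f(s) ds > 0`), and independent `U_a` with density
`f(a−s)/I(a)` on `[0,a]` and `V ~ κ⁻¹ x ρ(dx)`, adding the independent process
`r^{(a)}(t) = V f(t − U_a)` to `ψ` reproduces the law of `ψ` under the size-biased
measure `(ψ(a)/(κ I(a))) dP`, expressed through Laplace transforms. -/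
theorem convolution_size_biased_identity {Ω : Type*} [MeasurableSpace Ω] (P : Measure Ω)
    [IsProbabilityMeasure P]
    (f : ℝ → ℝ) (hf : Measurable f) (hfnonneg : ∀ u, 0 ≤ f u)
    (hfneg : ∀ u, u < 0 → f u = 0)
    (hfint : ∀ t : ℝ, 0 < t → IntegrableOn f (Set.Ioc 0 t) volume)
    (ρ : Measure ℝ) [SigmaFinite ρ] (hρsupp : ρ (Set.Iic 0) = 0)
    (κ : ℝ) (hκ : 0 < κ) (hκρ : ∫⁻ x, ENNReal.ofReal x ∂ρ = ENNReal.ofReal κ)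
    (ψ : ℝ → Ω → ℝ) (hψmeas : ∀ t, Measurable (ψ t)) (hψnonneg : ∀ t ω, 0 ≤ ψ t ω)
    (hLaplace : ∀ (n : ℕ) (t α : Fin n → ℝ),
      (∀ i, 0 ≤ t i) → StrictMono t → (∀ i, 0 ≤ α i) →
      ∫ ω, Real.exp (-(∑ i, α i * ψ (t i) ω)) ∂P =
        Real.exp (-(∫⁻ s in Set.Ioi (0 : ℝ), ∫⁻ x, ENNReal.ofReal
          (1 - Real.exp (-(∑ i, α i * (x * f (t i - s))))) ∂ρ).toReal))
    (a : ℝ) (ha : 0 < a) (hIa : 0 < ∫ s in Set.Ioc (0 : ℝ) a, f s)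
    (Ua V : Ω → ℝ) (hUa : Measurable Ua) (hV : Measurable V)
    (hUalaw : P.map Ua = volume.withDensity (Set.indicator (Set.Icc (0 : ℝ) a)
      (fun s => ENNReal.ofReal (f (a - s) / ∫ u in Set.Ioc (0 : ℝ) a, f u))))
    (hVlaw : P.map V = ρ.withDensity (fun x => ENNReal.ofReal (x / κ)))
    (hUaV : IndepFun Ua V P)
    (n : ℕ) (t α : Fin n → ℝ)
    (ht0 : ∀ i, 0 ≤ t i) (htmono : StrictMono t) (hα : ∀ i, 0 ≤ α i) :
    ∫ ω, ψ a ω * Real.exp (-(∑ i, α i * ψ (t i) ω)) ∂P =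
      κ * (∫ s in Set.Ioc (0 : ℝ) a, f s) *
        (∫ ω, Real.exp (-(∑ i, α i * ψ (t i) ω)) ∂P) *
        ∫ ω, Real.exp (-(V ω * ∑ i, α i * f (t i - Ua ω))) ∂P := by
  set m : Measure (ℝ × ℝ) := (volume.restrict (Set.Ioi (0 : ℝ))).prod ρ with hm
  set I := ∫ s in Set.Ioc (0 : ℝ) a, f s with hI
  have hρpos : ∀ᵐ x ∂ρ, 0 < x := by
    rw [ae_iff]
    simpa only [not_lt, Iic_def] using hρsupp
  have hmpos : ∀ᵐ z ∂m, 0 < z.2 := Measure.quasiMeasurePreserving_snd.ae hρpos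
  have hxint : Integrable (fun x : ℝ => x) ρ := by
    refine ⟨by fun_prop, ?_⟩
    rw [hasFiniteIntegral_iff_ofReal (hρpos.mono fun x hx => hx.le), hκρ]
    exact ENNReal.ofReal_lt_top
  have hmint : ∀ r, 0 ≤ r → Integrable (fun z : ℝ × ℝ => z.2 * f (r - z.1)) m := fun r hr => by
    have := Integrable.mul_prod (integrableOn_comp_sub_left_of_causal hfneg hfint hr) hxint
    simpa only [mul_comm] using this
  have hGint : ∀ {k : ℕ} (r β : Fin k → ℝ), (∀ i, 0 ≤ r i) →
      Integrable (fun z : ℝ × ℝ => ∑ i, β i * (z.2 * f (r i - z.1))) m := fun r β hr =>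
    integrable_finsetSum _ fun i _ => (hmint _ (hr i)).const_mul _
  have hGnonneg : ∀ {k : ℕ} (r β : Fin k → ℝ), (∀ i, 0 ≤ β i) →
      ∀ᵐ z ∂m, 0 ≤ ∑ i, β i * (z.2 * f (r i - z.1)) := fun r β hβ => by
    filter_upwards [hmpos] with z hz
    exact Finset.sum_nonneg fun i _ => mul_nonneg (hβ i) (mul_nonneg hz.le (hfnonneg _))
  have hLap : ∀ {k : ℕ} (r β : Fin k → ℝ), (∀ i, 0 ≤ r i) → StrictMono r → (∀ i, 0 ≤ β i) →
      ∫ ω, Real.exp (-(∑ i, β i * ψ (r i) ω)) ∂P =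
        Real.exp (-∫ z, (1 - Real.exp (-(∑ i, β i * (z.2 * f (r i - z.1))))) ∂m) := by
    intro k r β hr hmono hβ
    rw [hLaplace k r β hr hmono hβ, integral_eq_lintegral_of_nonneg_ae, hm,
      lintegral_prod _ (by fun_prop)]
    · filter_upwards [hGnonneg r β hβ] with z hz
      simpa using hz
    · fun_prop
  have hLapS : ∀ (S : Finset ℝ) (β : ℝ → ℝ), (∀ r ∈ S, 0 ≤ r) → (∀ r, 0 ≤ β r) →
      ∫ ω, Real.exp (-(∑ r ∈ S, β r * ψ r ω)) ∂P =
        Real.exp (-∫ z, (1 - Real.exp (-(∑ r ∈ S, β r * (z.2 * f (r - z.1))))) ∂m) := by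
    intro S β hS hβ
    have hsum : ∀ q : ℝ → ℝ, ∑ r ∈ S, q r = ∑ i, q (S.orderEmbOfFin rfl i) := fun q => by
      conv_lhs => rw [← Finset.image_orderEmbOfFin_univ S rfl]
      exact Finset.sum_image fun i _ j _ hij => (S.orderEmbOfFin rfl).injective hij
    simp only [hsum]
    exact hLap (fun i => S.orderEmbOfFin rfl i) (fun i => β (S.orderEmbOfFin rfl i))
      (fun i => hS _ (Finset.orderEmbOfFin_mem _ _ _)) (S.orderEmbOfFin rfl).strictMono
      (fun i => hβ _)
  have hLapθ : ∀ θ : ℝ, 0 ≤ θ →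
      ∫ ω, Real.exp (-(θ * ψ a ω + ∑ i, α i * ψ (t i) ω)) ∂P =
        Real.exp (-∫ z, (1 - Real.exp (-(θ * (z.2 * f (a - z.1)) +
          ∑ i, α i * (z.2 * f (t i - z.1))))) ∂m) := by
    intro θ hθ
    have := hLapS (insert a (Finset.univ.image t))
      (fun r => (if r = a then θ else 0) + ∑ i, if t i = r then α i else 0)
      (by
        intro r hr
        simp only [Finset.mem_insert, Finset.mem_image, Finset.mem_univ, true_and] at hr
        rcases hr with rfl | ⟨i, rfl⟩
        exacts [ha.le, ht0 i])
      (fun r => add_nonneg (by split_ifs <;> simp [hθ])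
        (Finset.sum_nonneg fun i _ => by split_ifs <;> simp [hα i]))
    have e1 : ∀ ω, _ := fun ω => sum_insert_image_collect t α a θ (fun r => ψ r ω)
    have e2 : ∀ z : ℝ × ℝ, _ := fun z =>
      sum_insert_image_collect t α a θ (fun r => z.2 * f (r - z.1))
    simp only [e1, e2] at this
    exact this
  have hmain := integral_mul_exp_neg_of_laplace P (m := m)
    (X := fun ω => ∑ i, α i * ψ (t i) ω) (Y := ψ a)
    (by fun_prop) (hψmeas a)
    (fun ω => Finset.sum_nonneg fun i _ => mul_nonneg (hα i) (hψnonneg _ _)) (hψnonneg a)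
    (hGint t α ht0) (hmint a ha.le) (hGnonneg t α hα)
    (hmpos.mono fun z hz => mul_nonneg hz.le (hfnonneg _)) hLapθ
  have hUlaw' : P.map Ua = (volume.restrict (Set.Ioi (0 : ℝ))).withDensity
      fun s => ENNReal.ofReal (f (a - s) / I) := by
    rw [hUalaw, ← withDensity_indicator measurableSet_Ioi]
    refine withDensity_congr_ae ?_
    filter_upwards [compl_mem_ae_iff.2 (measure_singleton (μ := volume) (0 : ℝ))] with s hs
    rcases lt_trichotomy s 0 with h | h | h
    · rw [indicator_of_notMem (by simp [h]), indicator_of_notMem (by simp [h.le])]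
    · exact absurd h hs
    · by_cases hsa : s ≤ a
      · rw [indicator_of_mem (mem_Icc.2 ⟨h.le, hsa⟩), indicator_of_mem (mem_Ioi.2 h)]
      · rw [indicator_of_notMem (by simp [hsa]), indicator_of_mem (mem_Ioi.2 h),
          hfneg _ (by linarith)]
        simp
  have hUV := IndepFun.integral_comp_withDensity hUa hV hUaV (p := fun s => f (a - s) / I)
    (q := fun x => x / κ) (by fun_prop) (by fun_prop) hUlaw' hVlaw
    (Eventually.of_forall fun s => div_nonneg (hfnonneg _) hIa.le)
    (hρpos.mono fun x hx => div_nonneg hx.le hκ.le)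
    (h := fun z => Real.exp (-(z.2 * ∑ i, α i * f (t i - z.1)))) (by fun_prop)
  have hK : ∫ z, z.2 * f (a - z.1) * Real.exp (-(∑ i, α i * (z.2 * f (t i - z.1)))) ∂m =
      κ * I * ∫ z, f (a - z.1) / I * (z.2 / κ) *
        Real.exp (-(z.2 * ∑ i, α i * f (t i - z.1))) ∂m := by
    rw [← integral_const_mul]
    refine integral_congr_ae (Eventually.of_forall fun z => ?_)
    have hsum : ∑ i, α i * (z.2 * f (t i - z.1)) = z.2 * ∑ i, α i * f (t i - z.1) := by
      rw [Finset.mul_sum]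
      exact Finset.sum_congr rfl fun i _ => by ring
    simp only [hsum]
    field_simp
  rw [hmain, hUV, hK]
  ring
end

section
/- Let α ∈ (0,1) and let (ψ(t))_{t≥0} be a nonnegative stochastic process on a probability space (Ω, P) such that E[exp(−∑_{i=1}^n uᵢ ψ(tᵢ))] = exp(−(α/Γ(1−α)) ∫₀^∞ ∫₀^∞ (1 − exp(−x ∑_{i=1}^n uᵢ 1_{[s,∞)}(tᵢ))) x^{−α−1} e^{−x} dx ds) for all n ≥ 1, 0 ≤ t₁ < … < tₙ and u₁,…,uₙ ≥ 0 (so ψ is the tempered α-stable subordinator with E[e^{−uψ(1)}] = exp(1−(1+u)^α)). Fix a > 0, let G be a random variable with the Gamma(1−α, 1) law (density x^{−α}e^{−x}/Γ(1−α) on (0,∞)) and U a standard uniform random variable, with G and U independent. Then for all n, all 0 ≤ t₁ < … < tₙ and all u₁,…,uₙ ≥ 0: E[ψ(a) · exp(−∑_{i=1}^n uᵢ ψ(tᵢ))] = αa · E[exp(−∑_{i=1}^n uᵢ ψ(tᵢ))] · E[exp(−G ∑_{i=1}^n uᵢ 1_{[aU,∞)}(tᵢ))]. That is, adding the independent process r^{(a)}(t)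 = G · 1_{[aU,∞)}(t) to ψ reproduces the law of ψ under the size-biased measure (ψ(a)/(αa)) dP. -/
open MeasureTheory ProbabilityTheory Set
open scoped ENNReal NNReal

/-- If the Laplace transform of `X` weighted by `exp (-Y)` has a right derivative at `0`, then
minus this derivative is the expectation of `X * exp (-Y)`. -/
lemma integral_mul_exp_neg_eq_of_hasDerivWithinAt {Ω : Type*} [MeasurableSpace Ω]
    {P : Measure Ω} [IsFiniteMeasure P] {X Y : Ω → ℝ} (hX : Measurable X) (hY : Measurable Y)
    (hX0 : ∀ ω, 0 ≤ X ω) (hY0 : ∀ ω, 0 ≤ Y ω) {d : ℝ}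
    (hd : HasDerivWithinAt (fun h : ℝ => ∫ ω, Real.exp (-(Y ω + h * X ω)) ∂P) d (Ici 0) 0) :
    ∫ ω, X ω * Real.exp (-Y ω) ∂P = -d := by
  have hint : ∀ h : ℝ, 0 ≤ h → Integrable (fun ω => Real.exp (-(Y ω + h * X ω))) P := by
    intro h hh
    refine Integrable.of_bound (by fun_prop) 1 (Filter.Eventually.of_forall fun ω => ?_)
    rw [Real.norm_eq_abs, abs_of_pos (Real.exp_pos _), Real.exp_le_one_iff]
    have := mul_nonneg hh (hX0 ω)
    linarith [hY0 ω]
  set η : ℕ → ℝ := fun k => 1 / ((k : ℝ) + 1) with hη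
  have hηpos : ∀ k, 0 < η k := fun k => by positivity
  have hηlim : Filter.Tendsto η Filter.atTop (nhds 0) := tendsto_one_div_add_atTop_nhds_zero_nat
  have hηlim' : Filter.Tendsto η Filter.atTop (nhdsWithin 0 (Ioi 0)) :=
    tendsto_nhdsWithin_iff.2 ⟨hηlim, Filter.Eventually.of_forall hηpos⟩
  set q : ℕ → Ω → ℝ := fun k ω =>
    (η k)⁻¹ * (Real.exp (-Y ω) - Real.exp (-(Y ω + η k * X ω))) with hq
  have hqmeas : ∀ k, Measurable (q k) := fun k => by fun_prop
  have hq0 : ∀ k ω, 0 ≤ q k ω := fun k ω => by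
    have h1 := mul_nonneg (hηpos k).le (hX0 ω)
    refine mul_nonneg (inv_nonneg.2 (hηpos k).le) (sub_nonneg.2 (Real.exp_le_exp.2 ?_))
    linarith
  have hqle : ∀ k ω, q k ω ≤ X ω * Real.exp (-Y ω) := fun k ω => by
    rw [hq]
    simp only
    rw [inv_mul_le_iff₀ (hηpos k), neg_add, Real.exp_add]
    have h1 := Real.add_one_le_exp (-(η k * X ω))
    nlinarith [Real.exp_pos (-Y ω)]
  have hqlim : ∀ ω, Filter.Tendsto (fun k => q k ω) Filter.atTop
      (nhds (X ω * Real.exp (-Y ω))) := fun ω => by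
    have h1 : HasDerivAt (fun h : ℝ => Real.exp (-(Y ω + h * X ω)))
        (Real.exp (-(Y ω + 0 * X ω)) * -(1 * X ω)) 0 :=
      ((((hasDerivAt_id (0 : ℝ)).mul_const (X ω)).const_add (Y ω)).neg).exp
    have h2 := (hasDerivWithinAt_iff_tendsto_slope.1 (h1.hasDerivWithinAt (s := Ici 0)))
    rw [Ici_sdiff_left] at h2
    have h3 := (h2.comp hηlim').neg
    rw [show -(Real.exp (-(Y ω + 0 * X ω)) * -(1 * X ω)) = X ω * Real.exp (-Y ω) by
      rw [zero_mul, add_zero]; ring] at h3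
    refine h3.congr fun k => ?_
    simp only [hq, Function.comp, slope_def_field, zero_mul, add_zero, sub_zero]
    ring
  have hqint : ∀ k, Integrable (q k) P := fun k => by
    have h0 : Integrable (fun ω => Real.exp (-Y ω)) P := by simpa using hint 0 le_rfl
    exact (h0.sub (hint _ (hηpos k).le)).const_mul _
  have hlim : Filter.Tendsto (fun k => ∫ ω, q k ω ∂P) Filter.atTop (nhds (-d)) := by
    have h2 := hasDerivWithinAt_iff_tendsto_slope.1 hd
    rw [Ici_sdiff_left] at h2
    have h3 := (h2.comp hηlim').neg
    refine h3.congr fun k => ?_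
    have h0 : Integrable (fun ω => Real.exp (-Y ω)) P := by simpa using hint 0 le_rfl
    rw [hq]
    simp only
    rw [integral_const_mul, integral_sub h0 (hint _ (hηpos k).le)]
    simp only [Function.comp, slope_def_field, zero_mul, add_zero, sub_zero]
    ring
  have hXint : Integrable (fun ω => X ω * Real.exp (-Y ω)) P := by
    refine ⟨by fun_prop, ?_⟩
    rw [hasFiniteIntegral_iff_ofReal
      (Filter.Eventually.of_forall fun ω => mul_nonneg (hX0 ω) (Real.exp_pos _).le)]
    calc ∫⁻ ω, ENNReal.ofReal (X ω * Real.exp (-Y ω)) ∂P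
        = ∫⁻ ω, Filter.liminf (fun k => ENNReal.ofReal (q k ω)) Filter.atTop ∂P :=
          lintegral_congr fun ω =>
            ((ENNReal.continuous_ofReal.tendsto _).comp (hqlim ω)).liminf_eq.symm
      _ ≤ Filter.liminf (fun k => ∫⁻ ω, ENNReal.ofReal (q k ω) ∂P) Filter.atTop :=
          lintegral_liminf_le fun k => (hqmeas k).ennreal_ofReal
      _ = Filter.liminf (fun k => ENNReal.ofReal (∫ ω, q k ω ∂P)) Filter.atTop := by
          congr 1
          funext k
          exact (ofReal_integral_eq_lintegral_ofReal (hqint k)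
            (Filter.Eventually.of_forall (hq0 k))).symm
      _ = ENNReal.ofReal (-d) :=
          ((ENNReal.continuous_ofReal.tendsto _).comp hlim).liminf_eq
      _ < ⊤ := ENNReal.ofReal_lt_top
  refine tendsto_nhds_unique (tendsto_integral_of_dominated_convergence
    (fun ω => X ω * Real.exp (-Y ω)) (fun k => (hqmeas k).aestronglyMeasurable) hXint
    (fun k => Filter.Eventually.of_forall fun ω => ?_)
    (Filter.Eventually.of_forall hqlim)) hlim
  rw [Real.norm_eq_abs, abs_of_nonneg (hq0 k ω)]
  exact hqle k ω

/-- A weighted sum of point evaluations plus one further weighted evaluation can be written with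
strictly increasing evaluation points. -/
lemma exists_strictMono_sum_mul_eq (n : ℕ) (t u : Fin n → ℝ) (ht0 : ∀ i, 0 ≤ t i)
    (hu : ∀ i, 0 ≤ u i) (a h : ℝ) (ha : 0 ≤ a) (hh : 0 ≤ h) :
    ∃ (m : ℕ) (t' u' : Fin m → ℝ), (∀ i, 0 ≤ t' i) ∧ StrictMono t' ∧ (∀ i, 0 ≤ u' i) ∧
      ∀ f : ℝ → ℝ, ∑ i, u' i * f (t' i) = ∑ i, u i * f (t i) + h * f a := by
  classical
  set T : Finset ℝ := insert a (Finset.univ.image t) with hT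
  set w : ℝ → ℝ := fun r => ∑ i, (if t i = r then u i else 0) + (if a = r then h else 0) with hw
  refine ⟨T.card, T.orderEmbOfFin rfl, fun i => w (T.orderEmbOfFin rfl i), fun i => ?_,
    (T.orderEmbOfFin rfl).strictMono, fun i => ?_, fun f => ?_⟩
  · have := T.orderEmbOfFin_mem rfl i
    have := (Finset.mem_insert.1 this).imp_right Finset.mem_image.1
    rcases this with h1 | ⟨j, -, h1⟩
    · rw [h1]; exact ha
    · rw [← h1]; exact ht0 j
  · refine add_nonneg (Finset.sum_nonneg fun j _ => ?_) ?_
    · split_ifs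
      exacts [hu j, le_rfl]
    · split_ifs
      exacts [hh, le_rfl]
  · have h1 : ∑ i, w (T.orderEmbOfFin rfl i) * f (T.orderEmbOfFin rfl i)
        = ∑ r ∈ T, w r * f r := by
      rw [← Finset.sum_coe_sort T]
      exact (T.orderIsoOfFin rfl).toEquiv.sum_comp (fun r : T => w r * f r)
    have haT : a ∈ T := by simp [hT]
    have htT : ∀ i, t i ∈ T := fun i => by simp [hT]
    rw [h1]
    simp only [hw, add_mul, Finset.sum_add_distrib, Finset.sum_mul, ite_mul, zero_mul]
    rw [Finset.sum_comm]
    simp [haT, htT]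

lemma integrableOn_rpow_neg_mul_exp_neg {α b : ℝ} (hα1 : α < 1) (hb : 0 < b) :
    IntegrableOn (fun x : ℝ => x ^ (-α) * Real.exp (-(b * x))) (Ioi 0) := by
  have := integrableOn_rpow_mul_exp_neg_mul_rpow (p := 1) (s := -α) (b := b)
    (by linarith) one_pos hb
  simpa [neg_mul] using this

lemma ae_pos_prod : ∀ᵐ z : ℝ × ℝ ∂((volume.restrict (Ioi (0 : ℝ))).prod
    (volume.restrict (Ioi (0 : ℝ)))), 0 < z.2 := by
  rw [Measure.prod_restrict]
  filter_upwards [ae_restrict_mem (measurableSet_Ioi.prod measurableSet_Ioi)] with z hz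
  exact hz.2

lemma integrable_ite_le (a : ℝ) :
    Integrable (fun s : ℝ => if s ≤ a then (1 : ℝ) else 0) (volume.restrict (Ioi 0)) := by
  have h : (fun s : ℝ => if s ≤ a then (1 : ℝ) else 0) = (Iic a).indicator (fun _ => 1) := by
    funext s; simp [indicator]
  rw [h, integrable_indicator_iff measurableSet_Iic]
  refine integrableOn_const ?_
  rw [Measure.restrict_apply measurableSet_Iic, inter_comm, Ioi_inter_Iic]
  simp

lemma rpow_neg_sub_one_mul_self {x : ℝ} (hx : 0 < x) (α : ℝ) :
    x ^ (-α - 1) * x = x ^ (-α) := by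
  rw [Real.rpow_sub_one hx.ne', div_mul_cancel₀ _ hx.ne']

/-- The derivative at `0` of the tempered stable Laplace exponent in the direction of `1_{[s,∞)}`
evaluated at time `a`. -/
lemma hasDerivAt_temperedStable_exponent {α : ℝ} (hα1 : α < 1) (a : ℝ) {g : ℝ → ℝ}
    (hg : Measurable g) (hg0 : ∀ s, 0 ≤ g s) (hgint : Integrable g (volume.restrict (Ioi 0))) :
    HasDerivAt (fun h : ℝ => ∫ z : ℝ × ℝ,
        (1 - Real.exp (-(z.2 * (g z.1 + h * (if z.1 ≤ a then (1 : ℝ) else 0))))) *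
          z.2 ^ (-α - 1) * Real.exp (-z.2)
        ∂((volume.restrict (Ioi (0 : ℝ))).prod (volume.restrict (Ioi (0 : ℝ)))))
      (∫ z : ℝ × ℝ, (if z.1 ≤ a then (1 : ℝ) else 0) *
          (Real.exp (-(z.2 * g z.1)) * (z.2 ^ (-α) * Real.exp (-z.2)))
        ∂((volume.restrict (Ioi (0 : ℝ))).prod (volume.restrict (Ioi (0 : ℝ))))) 0 := by
  have hι : Measurable fun s : ℝ => if s ≤ a then (1 : ℝ) else 0 :=
    Measurable.ite measurableSet_Iic measurable_const measurable_const
  have hι0 : ∀ s : ℝ, 0 ≤ (if s ≤ a then (1 : ℝ) else 0) := fun s => by split_ifs <;> simp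
  have hι1 : ∀ s : ℝ, (if s ≤ a then (1 : ℝ) else 0) ≤ 1 := fun s => by split_ifs <;> simp
  have hint := integrable_ite_le a
  set ι : ℝ → ℝ := fun s => if s ≤ a then (1 : ℝ) else 0 with hιdef
  change ∀ s, 0 ≤ ι s at hι0
  change ∀ s, ι s ≤ 1 at hι1
  have key := (hasDerivAt_integral_of_dominated_loc_of_deriv_le
    (μ := (volume.restrict (Ioi (0 : ℝ))).prod (volume.restrict (Ioi (0 : ℝ))))
    (F := fun (h : ℝ) (z : ℝ × ℝ) => (1 - Real.exp (-(z.2 * (g z.1 + h * ι z.1)))) *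
          z.2 ^ (-α - 1) * Real.exp (-z.2))
    (F' := fun (h : ℝ) (z : ℝ × ℝ) => Real.exp (-(z.2 * (g z.1 + h * ι z.1))) * (z.2 * ι z.1) *
          z.2 ^ (-α - 1) * Real.exp (-z.2))
    (bound := fun z => ι z.1 * (z.2 ^ (-α) * Real.exp (-(1 / 2 * z.2))))
    (x₀ := (0 : ℝ)) (s := Metric.ball 0 (1 / 2)) (Metric.ball_mem_nhds _ (by norm_num))
    ?_ ?_ ?_ ?_ ?_ ?_).2
  · refine key.congr_deriv (integral_congr_ae ?_)
    filter_upwards [ae_pos_prod] with z hz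
    simp only [zero_mul, add_zero]
    rw [← rpow_neg_sub_one_mul_self hz α]
    ring
  · refine Filter.Eventually.of_forall fun h => Measurable.aestronglyMeasurable ?_
    fun_prop
  · refine (hgint.mul_prod (integrableOn_rpow_neg_mul_exp_neg hα1 one_pos)).mono'
      (Measurable.aestronglyMeasurable (by fun_prop)) ?_
    filter_upwards [ae_pos_prod] with z hz
    simp only [zero_mul, add_zero, one_mul]
    have h1 : 0 ≤ z.2 * g z.1 := mul_nonneg hz.le (hg0 _)
    have h2 : 0 ≤ 1 - Real.exp (-(z.2 * g z.1)) := by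
      rw [sub_nonneg, Real.exp_le_one_iff]; linarith
    have h3 : 1 - Real.exp (-(z.2 * g z.1)) ≤ z.2 * g z.1 := by
      linarith [Real.add_one_le_exp (-(z.2 * g z.1))]
    have h4 : 0 < z.2 ^ (-α - 1) := Real.rpow_pos_of_pos hz _
    rw [Real.norm_eq_abs, abs_of_nonneg (by positivity), ← rpow_neg_sub_one_mul_self hz α]
    calc (1 - Real.exp (-(z.2 * g z.1))) * z.2 ^ (-α - 1) * Real.exp (-z.2)
        ≤ (z.2 * g z.1) * z.2 ^ (-α - 1) * Real.exp (-z.2) := by gcongr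
      _ = _ := by ring
  · refine Measurable.aestronglyMeasurable ?_
    fun_prop
  · filter_upwards [ae_pos_prod] with z hz h hh
    have h4 : 0 < z.2 ^ (-α - 1) := Real.rpow_pos_of_pos hz _
    have hh' : -(1 / 2) ≤ h := by
      rw [Metric.mem_ball, dist_zero_right, Real.norm_eq_abs, abs_lt] at hh
      exact hh.1.le
    have h5 := hι0 z.1
    have h6 : -(1 / 2) ≤ g z.1 + h * ι z.1 := by
      nlinarith [hι1 z.1, hg0 z.1]
    rw [Real.norm_eq_abs, abs_of_nonneg (by positivity), ← rpow_neg_sub_one_mul_self hz α]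
    calc Real.exp (-(z.2 * (g z.1 + h * ι z.1))) * (z.2 * ι z.1) * z.2 ^ (-α - 1) * Real.exp (-z.2)
        = ι z.1 * (z.2 ^ (-α - 1) * z.2 *
            Real.exp (-(z.2 * (g z.1 + h * ι z.1)) + -z.2)) := by
          rw [Real.exp_add]; ring
      _ ≤ _ := by
          gcongr
          nlinarith
  · exact hint.mul_prod (integrableOn_rpow_neg_mul_exp_neg hα1 (by norm_num))
  · refine Filter.Eventually.of_forall fun z h _ => ?_
    have h1 : HasDerivAt (fun h : ℝ => Real.exp (-(z.2 * (g z.1 + h * ι z.1))))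
        (Real.exp (-(z.2 * (g z.1 + h * ι z.1))) * -(z.2 * (1 * ι z.1))) h :=
      (((((hasDerivAt_id h).mul_const (ι z.1)).const_add (g z.1)).const_mul z.2).neg).exp
    refine ((((h1.const_sub 1).mul_const _).mul_const _)).congr_deriv ?_
    ring

/-- The double lower Lebesgue integral of the tempered stable exponent as a Bochner integral over
the product space. -/
lemma toReal_lintegral_temperedStable_exponent (α : ℝ) {g : ℝ → ℝ} (hg : Measurable g)
    (hg0 : ∀ s, 0 ≤ g s) :
    (∫⁻ s in Ioi (0 : ℝ), ∫⁻ x in Ioi (0 : ℝ), ENNReal.ofReal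
        ((1 - Real.exp (-(x * g s))) * x ^ (-α - 1) * Real.exp (-x))).toReal =
      ∫ z : ℝ × ℝ, (1 - Real.exp (-(z.2 * g z.1))) * z.2 ^ (-α - 1) * Real.exp (-z.2)
        ∂((volume.restrict (Ioi (0 : ℝ))).prod (volume.restrict (Ioi (0 : ℝ)))) := by
  rw [integral_eq_lintegral_of_nonneg_ae, lintegral_prod]
  · exact Measurable.aemeasurable (by fun_prop)
  · filter_upwards [ae_pos_prod] with z hz
    have h1 : 0 ≤ z.2 * g z.1 := mul_nonneg hz.le (hg0 _)
    have h2 : 0 ≤ 1 - Real.exp (-(z.2 * g z.1)) := by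
      rw [sub_nonneg, Real.exp_le_one_iff]; linarith
    have h4 : 0 < z.2 ^ (-α - 1) := Real.rpow_pos_of_pos hz _
    simp only [Pi.zero_apply]
    positivity
  · exact Measurable.aestronglyMeasurable (by fun_prop)

lemma integral_gammaMeasure_one_sub {α : ℝ} (hα1 : α < 1) (f : ℝ → ℝ) :
    ∫ x, f x ∂(gammaMeasure (1 - α) 1) =
      (Real.Gamma (1 - α))⁻¹ * ∫ x in Ioi (0 : ℝ), f x * (x ^ (-α) * Real.exp (-x)) := by
  have hmeas : Measurable (gammaPDF (1 - α) 1) := (measurable_gammaPDFReal _ _).ennreal_ofReal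
  rw [gammaMeasure, integral_withDensity_eq_integral_toReal_smul hmeas
    (Filter.Eventually.of_forall fun x => ENNReal.ofReal_lt_top),
    ← integral_const_mul, ← integral_indicator measurableSet_Ioi]
  refine integral_congr_ae ?_
  filter_upwards [compl_mem_ae_iff.2 (measure_singleton (0 : ℝ))] with x hx
  have hx0 : x ≠ 0 := hx
  rw [gammaPDF, ENNReal.toReal_ofReal (gammaPDFReal_nonneg (by linarith) one_pos x), gammaPDFReal]
  by_cases h : 0 < x
  · rw [if_pos h.le, indicator_of_mem (show x ∈ Ioi (0 : ℝ) from h), smul_eq_mul,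
      show 1 - α - 1 = -α by ring, Real.one_rpow, one_mul]
    ring
  · rw [if_neg (fun h' => h (lt_of_le_of_ne h' hx0.symm)),
      indicator_of_notMem (show x ∉ Ioi (0 : ℝ) from h), zero_smul]

/-- The Laplace functional of the single jump process `G * 1_{[aU,∞)}`. -/
lemma integral_exp_neg_gamma_mul_uniform {Ω : Type*} [MeasurableSpace Ω]
    {P : Measure Ω} [IsProbabilityMeasure P] {α : ℝ} (hα1 : α < 1) {a : ℝ} (ha : 0 < a)
    {G U : Ω → ℝ} (hG : Measurable G) (hU : Measurable U)
    (hGlaw : P.map G = gammaMeasure (1 - α) 1)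
    (hUlaw : P.map U = volume.restrict (Icc (0 : ℝ) 1)) (hGU : IndepFun G U P)
    {g : ℝ → ℝ} (hg : Measurable g) (hg0 : ∀ s, 0 ≤ g s) :
    ∫ z : ℝ × ℝ, (if z.1 ≤ a then (1 : ℝ) else 0) *
          (Real.exp (-(z.2 * g z.1)) * (z.2 ^ (-α) * Real.exp (-z.2)))
        ∂((volume.restrict (Ioi (0 : ℝ))).prod (volume.restrict (Ioi (0 : ℝ)))) =
      a * Real.Gamma (1 - α) * ∫ ω, Real.exp (-(G ω * g (a * U ω))) ∂P := by
  have hΓ : 0 < Real.Gamma (1 - α) := Real.Gamma_pos_of_pos (by linarith)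
  set K : ℝ → ℝ := fun s => ∫ x, Real.exp (-(x * g s)) ∂(gammaMeasure (1 - α) 1) with hK
  have : IsProbabilityMeasure (gammaMeasure (1 - α) 1) :=
    isProbabilityMeasure_gammaMeasure (by linarith) one_pos
  have hleft : ∫ z : ℝ × ℝ, (if z.1 ≤ a then (1 : ℝ) else 0) *
          (Real.exp (-(z.2 * g z.1)) * (z.2 ^ (-α) * Real.exp (-z.2)))
        ∂((volume.restrict (Ioi (0 : ℝ))).prod (volume.restrict (Ioi (0 : ℝ)))) =
      Real.Gamma (1 - α) * ∫ s in (0 : ℝ)..a, K s := by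
    have hι : Measurable fun s : ℝ => if s ≤ a then (1 : ℝ) else 0 :=
      Measurable.ite measurableSet_Iic measurable_const measurable_const
    rw [integral_prod]
    · have h1 : ∀ s : ℝ, ∫ x in Ioi (0 : ℝ), (if s ≤ a then (1 : ℝ) else 0) *
          (Real.exp (-(x * g s)) * (x ^ (-α) * Real.exp (-x))) =
          Real.Gamma (1 - α) * (Iic a).indicator K s := fun s => by
        rw [integral_const_mul]
        by_cases hs : s ≤ a
        · rw [if_pos hs, indicator_of_mem (show s ∈ Iic a from hs), hK]
          simp only
          rw [integral_gammaMeasure_one_sub hα1, mul_inv_cancel_left₀ hΓ.ne', one_mul]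
        · rw [if_neg hs, indicator_of_notMem (show s ∉ Iic a from hs)]
          simp
      simp only [h1]
      rw [integral_const_mul, integral_indicator measurableSet_Iic,
        Measure.restrict_restrict measurableSet_Iic, inter_comm, Ioi_inter_Iic,
        intervalIntegral.integral_of_le ha.le]
    · refine ((integrable_ite_le a).mul_prod
        (integrableOn_rpow_neg_mul_exp_neg hα1 one_pos)).mono'
        (((hι.comp measurable_fst).mul (by fun_prop)).aestronglyMeasurable) ?_
      filter_upwards [ae_pos_prod] with z hz
      have h1 : Real.exp (-(z.2 * g z.1)) ≤ 1 := by
        rw [Real.exp_le_one_iff]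
        linarith [mul_nonneg hz.le (hg0 z.1)]
      have h4 : 0 < z.2 ^ (-α) := Real.rpow_pos_of_pos hz _
      have h5 : 0 ≤ (if z.1 ≤ a then (1 : ℝ) else 0) := by split_ifs <;> simp
      rw [Real.norm_eq_abs, abs_of_nonneg (by positivity), one_mul]
      exact mul_le_mul_of_nonneg_left (mul_le_of_le_one_left (by positivity) h1) h5
  have hright : ∫ ω, Real.exp (-(G ω * g (a * U ω))) ∂P = a⁻¹ * ∫ s in (0 : ℝ)..a, K s := by
    have hmeas : Measurable fun p : ℝ × ℝ => Real.exp (-(p.2 * g (a * p.1))) := by fun_prop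
    have hjoint := (indepFun_iff_map_prod_eq_prod_map_map hU.aemeasurable hG.aemeasurable).1
      hGU.symm
    rw [hUlaw, hGlaw] at hjoint
    have h1 : ∫ ω, Real.exp (-(G ω * g (a * U ω))) ∂P =
        ∫ p : ℝ × ℝ, Real.exp (-(p.2 * g (a * p.1))) ∂(P.map fun ω => (U ω, G ω)) :=
      (integral_map (hU.prodMk hG).aemeasurable hmeas.aestronglyMeasurable).symm
    have hbd : ∀ᵐ p : ℝ × ℝ ∂(P.map fun ω => (U ω, G ω)),
        ‖Real.exp (-(p.2 * g (a * p.1)))‖ ≤ 1 := by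
      have h2 : ∀ᵐ x ∂(P.map G), 0 ≤ x := by
        have hpdf : Measurable (gammaPDF (1 - α) 1) :=
          (measurable_gammaPDFReal _ _).ennreal_ofReal
        rw [hGlaw, gammaMeasure, ae_withDensity_iff hpdf]
        refine Filter.Eventually.of_forall fun x hx => ?_
        by_contra hneg
        exact hx (by simp [gammaPDF, gammaPDFReal, hneg])
      have h3 : ∀ᵐ ω ∂P, 0 ≤ G ω := ae_of_ae_map hG.aemeasurable h2
      rw [ae_map_iff (hU.prodMk hG).aemeasurable (measurableSet_le hmeas.norm measurable_const)]
      filter_upwards [h3] with ω hω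
      rw [Real.norm_eq_abs, abs_of_pos (Real.exp_pos _), Real.exp_le_one_iff]
      linarith [mul_nonneg hω (hg0 (a * U ω))]
    have hprob : IsProbabilityMeasure (P.map fun ω => (U ω, G ω)) :=
      Measure.isProbabilityMeasure_map (hU.prodMk hG).aemeasurable
    have hint : Integrable (fun p : ℝ × ℝ => Real.exp (-(p.2 * g (a * p.1))))
        (P.map fun ω => (U ω, G ω)) :=
      Integrable.of_bound hmeas.aestronglyMeasurable 1 hbd
    rw [h1]
    rw [hjoint] at hint ⊢
    rw [integral_prod _ hint, integral_Icc_eq_integral_Ioc,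
      ← intervalIntegral.integral_of_le zero_le_one]
    have h2 := intervalIntegral.integral_comp_mul_left (a := 0) (b := 1) K ha.ne'
    rw [mul_zero, mul_one, smul_eq_mul] at h2
    exact h2
  rw [hleft, hright]
  field_simp

/-- for the tempered `α`-stable subordinator `ψ` (with
`E[e^{−uψ(1)}] = exp(1−(1+u)^α)`), an independent `G ~ Gamma(1−α,1)` and standard
uniform `U` (with `G`, `U` independent), adding the independent process
`r^{(a)}(t) = G·1_{[aU,∞)}(t)` to `ψ` reproduces the law of `ψ` under the size-biased
measure `(ψ(a)/(αa)) dP`, expressed through Laplace transforms. -/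
theorem tempered_stable_size_biased_identity {Ω : Type*} [MeasurableSpace Ω]
    (P : Measure Ω) [IsProbabilityMeasure P] (α : ℝ) (hα0 : 0 < α) (hα1 : α < 1)
    (ψ : ℝ → Ω → ℝ) (hψmeas : ∀ t, Measurable (ψ t)) (hψnonneg : ∀ t ω, 0 ≤ ψ t ω)
    (hLaplace : ∀ (n : ℕ) (t u : Fin n → ℝ),
      (∀ i, 0 ≤ t i) → StrictMono t → (∀ i, 0 ≤ u i) →
      ∫ ω, Real.exp (-(∑ i, u i * ψ (t i) ω)) ∂P =
        Real.exp (-(α / Real.Gamma (1 - α) *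
          (∫⁻ s in Set.Ioi (0 : ℝ), ∫⁻ x in Set.Ioi (0 : ℝ), ENNReal.ofReal
            ((1 - Real.exp (-(x * ∑ i, u i * (if s ≤ t i then (1 : ℝ) else 0)))) *
              x ^ (-α - 1) * Real.exp (-x))).toReal)))
    (a : ℝ) (ha : 0 < a)
    (G U : Ω → ℝ) (hG : Measurable G) (hU : Measurable U)
    (hGlaw : P.map G = gammaMeasure (1 - α) 1)
    (hUlaw : P.map U = volume.restrict (Set.Icc (0 : ℝ) 1))
    (hGU : IndepFun G U P)
    (n : ℕ) (t u : Fin n → ℝ)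
    (ht0 : ∀ i, 0 ≤ t i) (htmono : StrictMono t) (hu : ∀ i, 0 ≤ u i) :
    ∫ ω, ψ a ω * Real.exp (-(∑ i, u i * ψ (t i) ω)) ∂P =
      α * a * (∫ ω, Real.exp (-(∑ i, u i * ψ (t i) ω)) ∂P) *
        ∫ ω, Real.exp (-(G ω * ∑ i, u i * (if a * U ω ≤ t i then (1 : ℝ) else 0))) ∂P := by
  have hΓ : 0 < Real.Gamma (1 - α) := Real.Gamma_pos_of_pos (by linarith)
  set g : ℝ → ℝ := fun s => ∑ i, u i * (if s ≤ t i then (1 : ℝ) else 0) with hgdef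
  have hg : Measurable g := Finset.measurable_sum _ fun i _ =>
    (Measurable.ite measurableSet_Iic measurable_const measurable_const).const_mul _
  have hg0 : ∀ s, 0 ≤ g s := fun s => Finset.sum_nonneg fun i _ =>
    mul_nonneg (hu i) (by split_ifs <;> simp)
  have hgint : Integrable g (volume.restrict (Ioi 0)) :=
    integrable_finsetSum _ fun i _ => (integrable_ite_le (t i)).const_mul _
  set Λ : ℝ → ℝ := fun h => ∫ z : ℝ × ℝ,
    (1 - Real.exp (-(z.2 * (g z.1 + h * (if z.1 ≤ a then (1 : ℝ) else 0))))) *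
      z.2 ^ (-α - 1) * Real.exp (-z.2)
    ∂((volume.restrict (Ioi (0 : ℝ))).prod (volume.restrict (Ioi (0 : ℝ)))) with hΛ
  set D : ℝ := ∫ ω, Real.exp (-(G ω * g (a * U ω))) ∂P with hD
  have hΛderiv : HasDerivAt Λ (a * Real.Gamma (1 - α) * D) 0 :=
    (hasDerivAt_temperedStable_exponent hα1 a hg hg0 hgint).congr_deriv
      (integral_exp_neg_gamma_mul_uniform hα1 ha hG hU hGlaw hUlaw hGU hg hg0)
  have hL : ∀ h : ℝ, 0 ≤ h → ∫ ω, Real.exp (-(∑ i, u i * ψ (t i) ω + h * ψ a ω)) ∂P =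
      Real.exp (-(α / Real.Gamma (1 - α) * Λ h)) := by
    intro h hh
    obtain ⟨m, t', u', ht', hmono', hu', hsum⟩ :=
      exists_strictMono_sum_mul_eq n t u ht0 hu a h ha.le hh
    have h1 := hLaplace m t' u' ht' hmono' hu'
    simp only [fun ω => hsum fun r => ψ r ω,
      fun s : ℝ => hsum fun r => if s ≤ r then (1 : ℝ) else 0] at h1
    have hι : Measurable fun s : ℝ => if s ≤ a then (1 : ℝ) else 0 :=
      Measurable.ite measurableSet_Iic measurable_const measurable_const
    rw [h1, toReal_lintegral_temperedStable_exponent α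
      (g := fun s => g s + h * (if s ≤ a then (1 : ℝ) else 0)) (hg.add (hι.const_mul h))
      (fun s => add_nonneg (hg0 s) (mul_nonneg hh (by split_ifs <;> simp)))]
  have hL0 := hL 0 le_rfl
  simp only [zero_mul, add_zero] at hL0
  have hderiv := ((hΛderiv.const_mul (α / Real.Gamma (1 - α))).neg.exp).hasDerivWithinAt
    (s := Ici 0)
  have hbias := integral_mul_exp_neg_eq_of_hasDerivWithinAt (P := P) (hψmeas a)
    (Y := fun ω => ∑ i, u i * ψ (t i) ω)
    (Finset.measurable_sum _ fun i _ => (hψmeas (t i)).const_mul _) (hψnonneg a)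
    (fun ω => Finset.sum_nonneg fun i _ => mul_nonneg (hu i) (hψnonneg _ ω))
    (hderiv.congr (fun h hh => hL h hh) (hL 0 le_rfl))
  rw [hbias, hL0]
  simp only [Pi.neg_apply]
  field_simp
end
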